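/- arXiv:1105.0258 — 2 statements merged into one kernel-verified Lean document; each statement's English description precedes it below -/
import Mathlib

section
/- (Chudnovsky's Conjecture for generic points in P^3.) For every n ≥ 1 and all points p_1,…,p_n in general position in P^3, the radical ideal I = ∩_{j=1}^n m_{p_j} ⊆ k[P^3] satisfies α(I^(m)) ≥ m·(α(I)+2)/3 for all integers m ≥ 1. -/
open MvPolynomial Filter

/-- The homogeneous ideal of all forms vanishing at the (projective) point with
coordinate vector `p`. -/
noncomputable def pointIdeal {k : Type*} [Field k] {σ : Type*} (p : σ → k) :
    Ideal (MvPolynomial σ k) :=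
  Ideal.span { f | (∃ d, f.IsHomogeneous d) ∧ eval p f = 0 }

/-- The fat points ideal `⋂ⱼ m_{pⱼ}^{mⱼ}` (natural multiplicities). -/
noncomputable def fatIdeal {k : Type*} [Field k] {N n : ℕ} (p : Fin n → (Fin (N + 1) → k))
    (m : Fin n → ℕ) : Ideal (MvPolynomial (Fin (N + 1)) k) :=
  ⨅ j, pointIdeal (p j) ^ (m j)

/-- The fat points ideal with integer multiplicities, with the convention
`m_p^m = (1)` for `m ≤ 0`. -/
noncomputable def fatIdealZ {k : Type*} [Field k] {N n : ℕ} (p : Fin n → (Fin (N + 1) → k))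
    (m : Fin n → ℤ) : Ideal (MvPolynomial (Fin (N + 1)) k) :=
  ⨅ j, pointIdeal (p j) ^ (m j).toNat

/-- The irrelevant maximal ideal `M = (x_0, …, x_N)`. -/
noncomputable def maxIdeal (k : Type*) [Field k] (N : ℕ) : Ideal (MvPolynomial (Fin (N + 1)) k) :=
  Ideal.span (Set.range X)

/-- `α(I)`: the least `t ≥ 0` such that `I` contains a nonzero form of degree `t`. -/
noncomputable def alpha {k : Type*} [Field k] {σ : Type*}
    (I : Ideal (MvPolynomial σ k)) : ℕ :=
  sInf { t | ∃ f ∈ I, f ≠ 0 ∧ f.IsHomogeneous t }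

/-- The sequence `t ↦ α(I^{(t)})/t` attached to the fat points ideal with points `p`
and multiplicities `m`; its limit as `t → ∞` is the Waldschmidt constant `γ`. -/
noncomputable def alphaSeq {k : Type*} [Field k] {N n : ℕ}
    (p : Fin n → (Fin (N + 1) → k)) (m : Fin n → ℕ) (t : ℕ) : ℝ :=
  (alpha (fatIdeal p fun j => t * m j) : ℝ) / t

/-- `P` holds for `n`-tuples of points of `P^N` in general position: there is a
nonempty Zariski-open subset (the complement of the zero locus of a set `S` of
polynomials in the coordinates of the tuple) of tuples of nonzero coordinate
vectors on which `P` holds. -/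
def Generic (k : Type*) [Field k] (N n : ℕ)
    (P : (Fin n → (Fin (N + 1) → k)) → Prop) : Prop :=
  ∃ S : Set (MvPolynomial (Fin n × Fin (N + 1)) k),
    (∃ p : Fin n → (Fin (N + 1) → k), (∀ j, p j ≠ 0) ∧
      ∃ f ∈ S, eval (fun q => p q.1 q.2) f ≠ 0) ∧
    ∀ p : Fin n → (Fin (N + 1) → k), (∀ j, p j ≠ 0) →
      (∃ f ∈ S, eval (fun q => p q.1 q.2) f ≠ 0) → P p

/-! ### Multiplicity at an affine point -/

/-- Translation of coordinates by `P`. -/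
noncomputable def shiftBy {R : Type*} [CommRing R] {σ : Type*} (P : σ → R) :
    MvPolynomial σ R →ₐ[R] MvPolynomial σ R :=
  aeval (fun i => X i + C (P i))

/-- `f` vanishes to order at least `m` at the affine point `P`. -/
def VanOrd {R : Type*} [CommRing R] {σ : Type*} (P : σ → R) (m : ℕ) (f : MvPolynomial σ R) : Prop :=
  shiftBy P f ∈ idealOfVars σ R ^ m

theorem VanOrd.mul_left {R : Type*} [CommRing R] {σ : Type*} {P : σ → R} {m : ℕ}
    {f : MvPolynomial σ R} (g : MvPolynomial σ R) (h : VanOrd P m f) : VanOrd P m (g * f) := by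
  unfold VanOrd at *
  rw [map_mul]
  exact Ideal.mul_mem_left _ _ h

theorem VanOrd.pow {R : Type*} [CommRing R] {σ : Type*} {P : σ → R} {m : ℕ}
    {f : MvPolynomial σ R} (h : VanOrd P m f) (r : ℕ) : VanOrd P (m * r) (f ^ r) := by
  unfold VanOrd at *
  rw [map_pow, pow_mul]
  exact Ideal.pow_mem_pow h r

theorem VanOrd.mono {R : Type*} [CommRing R] {σ : Type*} {P : σ → R} {m m' : ℕ}
    {f : MvPolynomial σ R} (h : VanOrd P m f) (hm : m' ≤ m) : VanOrd P m' f :=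
  Ideal.pow_le_pow_right hm h

theorem shiftBy_map {R S : Type*} [CommRing R] [CommRing S] {σ : Type*} (φ : R →+* S) (P : σ → R)
    (f : MvPolynomial σ R) :
    shiftBy (fun i => φ (P i)) (map φ f) = map φ (shiftBy P f) := by
  induction f using MvPolynomial.induction_on with
  | C a => simp [shiftBy]
  | add p q hp hq => simp only [map_add, hp, hq]
  | mul_X p i hp => simp only [map_mul, hp]; simp [shiftBy]

theorem VanOrd.map {R S : Type*} [CommRing R] [CommRing S] {σ : Type*} (φ : R →+* S) {P : σ → R}
    {m : ℕ} {f : MvPolynomial σ R} (h : VanOrd P m f) :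
    VanOrd (fun i => φ (P i)) m (MvPolynomial.map φ f) := by
  unfold VanOrd at *
  rw [shiftBy_map]
  rw [mem_pow_idealOfVars_iff'] at *
  intro x hx
  rw [coeff_map, h x hx, map_zero]

theorem VanOrd.of_map {R S : Type*} [CommRing R] [CommRing S] {σ : Type*} (φ : R →+* S)
    (hφ : Function.Injective φ) {P : σ → R}
    {m : ℕ} {f : MvPolynomial σ R} (h : VanOrd (fun i => φ (P i)) m (MvPolynomial.map φ f)) :
    VanOrd P m f := by
  unfold VanOrd at *
  rw [shiftBy_map] at h
  rw [mem_pow_idealOfVars_iff'] at *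
  intro x hx
  have := h x hx
  rw [coeff_map] at this
  exact hφ (by rw [this, map_zero])

theorem constantCoeff_shiftBy {R : Type*} [CommRing R] {σ : Type*} (P : σ → R)
    (f : MvPolynomial σ R) : coeff 0 (shiftBy P f) = eval P f := by
  have : (constantCoeff.comp (shiftBy P).toRingHom) = eval P := by
    ext i
    · simp [shiftBy]
    · simp [shiftBy]
  exact congrArg (fun φ : MvPolynomial σ R →+* R => φ f) this

theorem vanOrd_of_mem {k : Type*} [Field k] {σ : Type*} (p : σ → k) (m : ℕ)
    (f : MvPolynomial σ k) (h : f ∈ pointIdeal p ^ m) : VanOrd p m f := by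
  have h1 : (pointIdeal p).map (shiftBy p) ≤ idealOfVars σ k := by
    unfold pointIdeal
    rw [Ideal.map_span, Ideal.span_le]
    rintro _ ⟨g, ⟨_, hg⟩, rfl⟩
    have := (mem_pow_idealOfVars_iff' (σ := σ) (R := k) 1 (shiftBy p g)).mpr (by
      intro x hx
      have : x = 0 := by
        rw [← Finsupp.degree_eq_zero_iff]; omega
      rw [this, constantCoeff_shiftBy, hg])
    simpa using this
  have h2 : shiftBy p f ∈ ((pointIdeal p) ^ m).map (shiftBy p) := Ideal.mem_map_of_mem _ h
  rw [Ideal.map_pow] at h2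
  exact Ideal.pow_right_mono h1 m h2

/-! ### Hyperplane restriction -/

/-- Substitute the constant `a` for the variable `X 0`. -/
noncomputable def subst0 {R : Type*} [CommRing R] {N : ℕ} (a : R) :
    MvPolynomial (Fin (N + 1)) R →ₐ[R] MvPolynomial (Fin N) R :=
  aeval (Fin.cons (C a) X : Fin (N + 1) → MvPolynomial (Fin N) R)

theorem VanOrd.subst0 {R : Type*} [CommRing R] {N : ℕ} (a : R) (P : Fin N → R) {m : ℕ}
    {f : MvPolynomial (Fin (N + 1)) R}
    (h : VanOrd (Fin.cons a P : Fin (N + 1) → R) m f) : VanOrd P m (subst0 a f) := by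
  unfold VanOrd at *
  have h0 : ((shiftBy P).comp (_root_.subst0 (N := N) a)) =
      (_root_.subst0 0).comp (shiftBy (Fin.cons a P : Fin (N + 1) → R)) := by
    ext i : 1
    refine Fin.cases ?_ (fun j => ?_) i
    · simp [_root_.subst0, shiftBy]
    · simp [_root_.subst0, shiftBy]
  have h1 : (idealOfVars (Fin (N + 1)) R).map (_root_.subst0 (N := N) (0 : R)) ≤
      idealOfVars (Fin N) R := by
    rw [idealOfVars, Ideal.map_span, Ideal.span_le]
    rintro _ ⟨_, ⟨i, rfl⟩, rfl⟩
    refine Fin.cases ?_ (fun j => ?_) i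
    · simp [_root_.subst0]
    · simp only [_root_.subst0, aeval_X, Fin.cons_succ]
      exact Ideal.subset_span ⟨j, rfl⟩
  have h2 := Ideal.mem_map_of_mem (_root_.subst0 (N := N) (0 : R)) h
  rw [Ideal.map_pow] at h2
  have h3 := Ideal.pow_right_mono h1 m h2
  have h4 := congrArg (fun φ => φ f) h0
  simp only [AlgHom.comp_apply] at h4
  rw [h4]; exact h3

theorem subst0_eq {R : Type*} [CommRing R] {N : ℕ} (a : R) (f : MvPolynomial (Fin (N + 1)) R) :
    subst0 a f = (finSuccEquiv R N f).eval (C a) := by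
  induction f using MvPolynomial.induction_on with
  | C b => simp [subst0, finSuccEquiv_apply]
  | add p q hp hq => simp only [map_add, hp, hq, Polynomial.eval_add]
  | mul_X p i hp =>
    simp only [map_mul, hp, Polynomial.eval_mul]
    congr 1
    refine Fin.cases ?_ (fun j => ?_) i
    · simp [subst0, finSuccEquiv_X_zero]
    · simp [subst0, finSuccEquiv_X_succ]

theorem totalDegree_subst0_le {R : Type*} [CommRing R] {N : ℕ} (a : R)
    (f : MvPolynomial (Fin (N + 1)) R) : (subst0 a f).totalDegree ≤ f.totalDegree := by
  rw [subst0_eq, Polynomial.eval_eq_sum]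
  refine totalDegree_finsetSum_le ?_
  intro i hi
  have := totalDegree_coeff_finSuccEquiv_add_le f i (by simpa using hi)
  refine (totalDegree_mul _ _).trans ?_
  have h2 := totalDegree_pow (C a : MvPolynomial (Fin N) R) i
  rw [totalDegree_C] at h2
  omega

theorem dvd_of_subst0_eq_zero {R : Type*} [CommRing R] {N : ℕ} (a : R)
    (f : MvPolynomial (Fin (N + 1)) R) (h : subst0 a f = 0) : (X 0 - C a) ∣ f := by
  rw [subst0_eq] at h
  obtain ⟨g, hg⟩ := Polynomial.dvd_iff_isRoot.mpr h
  refine ⟨(finSuccEquiv R N).symm g, ?_⟩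
  apply (finSuccEquiv R N).injective
  rw [map_mul, AlgEquiv.apply_symm_apply, hg, map_sub, finSuccEquiv_X_zero]
  congr 2
  simp [finSuccEquiv_apply]

theorem mem_pow_of_unit_mul {k : Type*} [Field k] {σ : Type*} (c : k) (hc : c ≠ 0) (i : σ) (m : ℕ)
    (g : MvPolynomial σ k) (h : (X i + C c) * g ∈ idealOfVars σ k ^ m) :
    g ∈ idealOfVars σ k ^ m := by
  have key : ∀ j ≤ m, g ∈ idealOfVars σ k ^ j := by
    intro j
    induction j with
    | zero => simp
    | succ j ih =>
      intro hj
      have h1 := ih (by omega)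
      have h2 : X i * g ∈ idealOfVars σ k ^ (j + 1) := by
        rw [pow_succ']
        exact Ideal.mul_mem_mul (Ideal.subset_span ⟨i, rfl⟩) h1
      have h3 := Ideal.sub_mem _ (Ideal.pow_le_pow_right hj h) h2
      have h4 := Ideal.mul_mem_left _ (C c⁻¹) h3
      have h5 : C c⁻¹ * ((X i + C c) * g - X i * g) = g := by
        have : (C c⁻¹ * C c : MvPolynomial σ k) = 1 := by
          rw [← C_mul, inv_mul_cancel₀ hc, C_1]
        linear_combination g * this
      rwa [h5] at h4
  exact key m le_rfl

theorem mem_pow_of_X_mul {R : Type*} [CommRing R] {σ : Type*} (i : σ) (m : ℕ)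
    (g : MvPolynomial σ R) (h : X i * g ∈ idealOfVars σ R ^ (m + 1)) :
    g ∈ idealOfVars σ R ^ m := by
  rw [mem_pow_idealOfVars_iff'] at *
  intro x hx
  have := h (Finsupp.single i 1 + x) (by rw [map_add, Finsupp.degree_single]; omega)
  rwa [coeff_X_mul] at this

theorem VanOrd.div_same {k : Type*} [Field k] {N : ℕ} {P : Fin (N + 1) → k} {m : ℕ}
    {g : MvPolynomial (Fin (N + 1)) k}
    (h : VanOrd P (m + 1) ((X 0 - C (P 0)) * g)) : VanOrd P m g := by
  unfold VanOrd at *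
  rw [map_mul] at h
  have : shiftBy P (X 0 - C (P 0)) = X 0 := by
    simp [shiftBy]
  rw [this] at h
  exact mem_pow_of_X_mul _ _ _ h

theorem VanOrd.div_ne {k : Type*} [Field k] {N : ℕ} {P : Fin (N + 1) → k} {m : ℕ} {a : k}
    (ha : P 0 ≠ a) {g : MvPolynomial (Fin (N + 1)) k}
    (h : VanOrd P m ((X 0 - C a) * g)) : VanOrd P m g := by
  unfold VanOrd at *
  rw [map_mul] at h
  have : shiftBy P (X 0 - C a) = X 0 + C (P 0 - a) := by
    simp [shiftBy]; ring
  rw [this] at h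
  exact mem_pow_of_unit_mul _ (sub_ne_zero.mpr ha) _ _ _ h

theorem totalDegree_lin {k : Type*} [Field k] {N : ℕ} (a : k) :
    (X 0 - C a : MvPolynomial (Fin (N + 1)) k).totalDegree = 1 := by
  apply le_antisymm
  · refine (totalDegree_sub _ _).trans ?_
    simp
  · have : (Finsupp.single 0 1) ∈ (X 0 - C a : MvPolynomial (Fin (N + 1)) k).support := by
      rw [mem_support_iff, coeff_sub, coeff_C, if_neg]
      · simp
      · intro h; have := congrArg Finsupp.degree h; simp at this
    simpa using le_totalDegree this

theorem totalDegree_lin_mul {k : Type*} [Field k] {N : ℕ} (a : k)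
    (g : MvPolynomial (Fin (N + 1)) k) (hg : g ≠ 0) :
    ((X 0 - C a) * g).totalDegree = g.totalDegree + 1 := by
  rw [totalDegree_mul_of_isDomain _ hg, totalDegree_lin, add_comm]
  intro h
  have := totalDegree_lin (N := N) a
  rw [h] at this
  simp at this

/-- Polynomials vanishing to order `m` on a `K × ⋯ × K` grid have degree at least `K * m`. -/
theorem grid_zero {k : Type*} [Field k] (K : ℕ) : ∀ (N : ℕ) (s : Fin N → Fin K → k)
    (_ : ∀ i, Function.Injective (s i)) (m : ℕ) (f : MvPolynomial (Fin N) k),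
    f.totalDegree < K * m → (∀ φ : Fin N → Fin K, VanOrd (fun i => s i (φ i)) m f) → f = 0 := by
  intro N
  induction N with
  | zero =>
    intro s _ m f hf h
    have h1 := h (fun i => i.elim0)
    unfold VanOrd at h1
    rw [mem_pow_idealOfVars_iff'] at h1
    have hm : 0 < m := by
      rcases Nat.eq_zero_or_pos m with h | h
      · subst h; simp at hf
      · exact h
    have h2 := h1 0 (by simpa using hm)
    rw [constantCoeff_shiftBy] at h2
    rw [eq_C_of_isEmpty f] at h2 ⊢
    rw [eval_C] at h2
    rw [h2, C_0]
  | succ N ihN =>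
    intro s hs m
    induction m with
    | zero => intro f hf; simp at hf
    | succ m ihm =>
      intro f hf h
      by_contra hf0
      have key : ∀ S : Finset (Fin K), ∃ g : MvPolynomial (Fin (N + 1)) k, g ≠ 0 ∧
          g.totalDegree + S.card = f.totalDegree ∧
          (∀ φ : Fin (N + 1) → Fin K, VanOrd (fun i => s i (φ i)) m g) ∧
          (∀ φ : Fin (N + 1) → Fin K, φ 0 ∉ S → VanOrd (fun i => s i (φ i)) (m + 1) g) := by
        intro S
        induction S using Finset.induction_on with
        | empty => exact ⟨f, hf0, by simp, fun φ => (h φ).mono (by omega), fun φ _ => h φ⟩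
        | insert a S ha ih =>
          obtain ⟨g, hg0, hgd, h1, h2⟩ := ih
          have hz : subst0 (s 0 a) g = 0 := by
            apply ihN (fun i => s i.succ) (fun i => hs i.succ) (m + 1)
            · have := totalDegree_subst0_le (s 0 a) g
              omega
            · intro φ
              apply VanOrd.subst0
              have := h2 (Fin.cons a φ) (by simpa using ha)
              convert this using 1
              funext i
              refine Fin.cases ?_ (fun j => ?_) i <;> simp
          obtain ⟨g', rfl⟩ := dvd_of_subst0_eq_zero _ _ hz
          have hg0' : g' ≠ 0 := right_ne_zero_of_mul hg0
          have same : ∀ φ : Fin (N + 1) → Fin K, φ 0 = a → VanOrd (fun i => s i (φ i)) m g' := by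
            intro φ hφ
            apply VanOrd.div_same
            have := h2 φ (by rw [hφ]; exact ha)
            simpa only [hφ] using this
          have diff : ∀ (M : ℕ) (φ : Fin (N + 1) → Fin K), φ 0 ≠ a →
              VanOrd (fun i => s i (φ i)) M ((X 0 - C (s 0 a)) * g') →
              VanOrd (fun i => s i (φ i)) M g' := by
            intro M φ hφ hh
            exact VanOrd.div_ne (fun e => hφ (hs 0 e)) hh
          refine ⟨g', hg0', ?_, ?_, ?_⟩
          · rw [totalDegree_lin_mul _ _ hg0'] at hgd
            rw [Finset.card_insert_of_notMem ha]; omega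
          · intro φ
            by_cases hφ : φ 0 = a
            · exact same φ hφ
            · exact diff _ φ hφ (h1 φ)
          · intro φ hφ
            rw [Finset.mem_insert, not_or] at hφ
            exact diff _ φ hφ.1 (h2 φ hφ.2)
      obtain ⟨g, hg0, hgd, h1, -⟩ := key Finset.univ
      rw [Finset.card_univ, Fintype.card_fin] at hgd
      exact hg0 (ihm g (by rw [mul_add] at hf; omega) h1)

theorem vanOrd_zero_of_lt {k : Type*} [Field k] {N : ℕ} (P : Fin N → k) (m : ℕ)
    (f : MvPolynomial (Fin N) k) (hf : f.totalDegree < m) (h : VanOrd P m f) : f = 0 :=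
  grid_zero 1 N (fun i _ => P i) (fun _ _ _ _ => Subsingleton.elim _ _) m f (by omega) (fun _ => h)

/-! ### Special configurations -/

theorem two_planes (M : ℕ) : ∀ (m : ℕ) (f : MvPolynomial (Fin 3) ℚ), f.totalDegree < 3 * m →
    3 * f.totalDegree < 6 * m + M →
    (∀ (b : Fin 2) (φ : Fin 2 → Fin 3),
      VanOrd (Fin.cons ((b : ℕ) : ℚ) (fun i => ((φ i : ℕ) : ℚ)) : Fin 3 → ℚ) m f) →
    VanOrd (Fin.cons 2 (fun _ => 0) : Fin 3 → ℚ) M f → f = 0 := by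
  intro m
  induction m with
  | zero => intro f hf; simp at hf
  | succ m ih =>
    intro f hf hM h hx
    by_contra hf0
    have hz : ∀ (b : Fin 2) (g : MvPolynomial (Fin 3) ℚ), g.totalDegree < 3 * (m + 1) →
        (∀ (φ : Fin 2 → Fin 3),
          VanOrd (Fin.cons ((b : ℕ) : ℚ) (fun i => ((φ i : ℕ) : ℚ)) : Fin 3 → ℚ) (m + 1) g) →
        (X 0 - C ((b : ℕ) : ℚ)) ∣ g := by
      intro b g hg hv
      apply dvd_of_subst0_eq_zero
      apply grid_zero 3 2 (fun _ j => ((j : ℕ) : ℚ)) _ (m + 1)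
      · exact (totalDegree_subst0_le _ _).trans_lt hg
      · intro φ
        exact VanOrd.subst0 _ _ (hv φ)
      · intro i a b h
        exact Fin.ext (Nat.cast_injective (R := ℚ) h)
    obtain ⟨g, rfl⟩ := hz 0 f hf (h 0)
    have hg0 : g ≠ 0 := right_ne_zero_of_mul hf0
    rw [totalDegree_lin_mul _ _ hg0] at hf hM
    have h1 : ∀ φ : Fin 2 → Fin 3,
        VanOrd (Fin.cons (((1 : Fin 2) : ℕ) : ℚ) (fun i => ((φ i : ℕ) : ℚ)) : Fin 3 → ℚ)
          (m + 1) g := fun φ => VanOrd.div_ne (by simp) (h 1 φ)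
    have h0 : ∀ φ : Fin 2 → Fin 3,
        VanOrd (Fin.cons (((0 : Fin 2) : ℕ) : ℚ) (fun i => ((φ i : ℕ) : ℚ)) : Fin 3 → ℚ)
          m g := fun φ => VanOrd.div_same (h 0 φ)
    have hx1 := VanOrd.div_ne (by simp) hx
    obtain ⟨g', rfl⟩ := hz 1 g (by omega) h1
    have hg0' : g' ≠ 0 := right_ne_zero_of_mul hg0
    rw [totalDegree_lin_mul _ _ hg0'] at hf hM
    have h1' : ∀ φ : Fin 2 → Fin 3,
        VanOrd (Fin.cons (((1 : Fin 2) : ℕ) : ℚ) (fun i => ((φ i : ℕ) : ℚ)) : Fin 3 → ℚ)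
          m g' := fun φ => VanOrd.div_same (h1 φ)
    have h0' : ∀ φ : Fin 2 → Fin 3,
        VanOrd (Fin.cons (((0 : Fin 2) : ℕ) : ℚ) (fun i => ((φ i : ℕ) : ℚ)) : Fin 3 → ℚ)
          m g' := fun φ => VanOrd.div_ne (by simp) (h0 φ)
    have hx2 := VanOrd.div_ne (by norm_num) hx1
    apply hg0'
    by_cases hlt : g'.totalDegree < 3 * m
    · apply ih g' hlt (by omega) _ hx2
      intro b φ
      fin_cases b
      · exact h0' φ
      · exact h1' φ
    · exact vanOrd_zero_of_lt _ M g' (by omega) hx2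

/-- No nonzero form of degree `T` vanishes to order `m` at all the points. -/
def NoForm {R : Type*} [CommRing R] {n : ℕ} (p : Fin n → Fin 4 → R) (m T : ℕ) : Prop :=
  ∀ f : MvPolynomial (Fin 4) R, f.IsHomogeneous T → (∀ j, VanOrd (p j) m f) → f = 0

theorem noForm_of_affine {n : ℕ} (q : Fin n → Fin 3 → ℤ) (m T : ℕ)
    (h : ∀ f : MvPolynomial (Fin 3) ℚ, f.totalDegree ≤ T →
      (∀ j, VanOrd (fun i => (q j i : ℚ)) m f) → f = 0) :
    NoForm (fun j i => (((Fin.cons 1 (q j) : Fin 4 → ℤ) i : ℤ) : ℚ)) m T := by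
  intro f hf hv
  have h1 : subst0 1 f = 0 := by
    apply h
    · exact (totalDegree_subst0_le _ _).trans hf.totalDegree_le
    · intro j
      apply VanOrd.subst0
      convert hv j using 1
      funext i
      refine Fin.cases ?_ (fun j => ?_) i <;> simp
  have h2 : X 0 * f = 0 := by
    apply MvPolynomial.funext
    intro v
    rw [map_mul, eval_X, map_zero]
    by_cases hv0 : v 0 = 0
    · rw [hv0, zero_mul]
    · have e : eval (fun i => (v 0)⁻¹ * v i) f = 0 := by
        obtain ⟨g, hg⟩ := dvd_of_subst0_eq_zero _ _ h1
        rw [hg, map_mul]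
        simp [hv0]
      have e2 : eval (fun i => (v 0)⁻¹ * v i) f = (v 0)⁻¹ ^ T * eval v f := by
        rw [eval_eq, eval_eq, Finset.mul_sum]
        refine Finset.sum_congr rfl fun d hd => ?_
        have hd' : d.degree = T := by
          by_contra hne
          exact (mem_support_iff.mp hd) (hf.coeff_eq_zero hne)
        simp only [mul_pow, Finset.prod_mul_distrib, Finset.prod_pow_eq_pow_sum]
        rw [← hd', Finsupp.degree_eq_sum]
        have h2 : ∑ i ∈ d.support, d i = ∑ i, d i :=
          Finset.sum_subset (Finset.subset_univ _) (by intro x _ hx; simpa using hx)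
        rw [h2]
        ring
      rw [e2] at e
      rcases mul_eq_zero.mp e with h | h
      · exact absurd h (pow_ne_zero _ (inv_ne_zero hv0))
      · rw [h, mul_zero]
  exact (mul_eq_zero.mp h2).resolve_left (X_ne_zero 0)

theorem exists_config_grid (n K m T : ℕ) (hK : 0 < K) (hn : K ^ 3 ≤ n) (hT : T < K * m) :
    ∃ q : Fin n → Fin 3 → ℤ, ∀ f : MvPolynomial (Fin 3) ℚ, f.totalDegree ≤ T →
      (∀ j, VanOrd (fun i => (q j i : ℚ)) m f) → f = 0 := by
  have : Nonempty (Fin 3 → Fin K) := ⟨fun _ => ⟨0, hK⟩⟩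
  obtain ⟨e⟩ : Nonempty ((Fin 3 → Fin K) ↪ Fin n) := by
    apply Function.Embedding.nonempty_of_card_le
    simpa using hn
  refine ⟨fun j i => ((Function.invFun e j i : Fin K) : ℕ), fun f hf h => ?_⟩
  apply grid_zero K 3 (fun _ j => ((j : ℕ) : ℚ)) _ m f (by omega)
  · intro φ
    have := h (e φ)
    simp only [Function.leftInverse_invFun e.injective φ] at this
    simpa using this
  · intro i a b h
    exact Fin.ext (Nat.cast_injective (R := ℚ) h)

theorem exists_config_20 (n : ℕ) (hn : 20 ≤ n) :
    ∃ q : Fin n → Fin 3 → ℤ, ∀ f : MvPolynomial (Fin 3) ℚ, f.totalDegree ≤ 41 →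
      (∀ j, VanOrd (fun i => (q j i : ℚ)) 18 f) → f = 0 := by
  let Q : Option (Fin 2 × (Fin 2 → Fin 3)) → Fin 3 → ℤ := fun o =>
    o.elim (Fin.cons 2 (fun _ => 0)) (fun x => Fin.cons ((x.1 : ℕ) : ℤ) (fun i => ((x.2 i : ℕ) : ℤ)))
  obtain ⟨e⟩ : Nonempty (Option (Fin 2 × (Fin 2 → Fin 3)) ↪ Fin n) := by
    apply Function.Embedding.nonempty_of_card_le
    simp
    omega
  refine ⟨fun j => Q (Function.invFun e j), fun f hf h => ?_⟩
  apply two_planes 18 18 f (by omega) (by omega)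
  · intro b φ
    have := h (e (some (b, φ)))
    simp only [Function.leftInverse_invFun e.injective _] at this
    convert this using 1
    funext i
    refine Fin.cases ?_ (fun j => ?_) i <;> simp [Q]
  · have := h (e none)
    simp only [Function.leftInverse_invFun e.injective _] at this
    convert this using 1
    funext i
    refine Fin.cases ?_ (fun j => ?_) i <;> simp [Q]

/-! ### Frobenius roots -/

section Frob

variable {F : Type*} [Field F] (q : ℕ) (ρ : F →+* F)

open Classical in
/-- The coefficient of `x ^ b` in the expansion of `f` over the ring of `q`-th powers,
as a `q`-th root. -/
noncomputable def frobCoeff (b : Fin 4 →₀ ℕ) (f : MvPolynomial (Fin 4) F) :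
    MvPolynomial (Fin 4) F :=
  ∑ c ∈ f.support, if h : ∃ a, c = b + q • a then monomial h.choose (ρ (coeff c f)) else 0

theorem coeff_frobCoeff (hq : 0 < q) (b a : Fin 4 →₀ ℕ) (f : MvPolynomial (Fin 4) F) :
    coeff a (frobCoeff q ρ b f) = ρ (coeff (b + q • a) f) := by
  classical
  unfold frobCoeff
  rw [coeff_sum]
  have : ∀ c ∈ f.support, coeff a (if h : ∃ a, c = b + q • a then
      monomial h.choose (ρ (coeff c f)) else 0) =
      if c = b + q • a then ρ (coeff c f) else 0 := by
    intro c _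
    split_ifs with h1 h2 h2
    · rw [coeff_monomial, if_pos]
      have h3 := add_left_cancel (h2.symm.trans h1.choose_spec)
      ext i
      have h4 := DFunLike.congr_fun h3 i
      simp only [Finsupp.smul_apply, smul_eq_mul] at h4
      exact (Nat.eq_of_mul_eq_mul_left hq h4).symm
    · rw [coeff_monomial, if_neg]
      intro h
      exact h2 (h ▸ h1.choose_spec)
    · exact absurd ⟨a, h2⟩ h1
    · simp
  rw [Finset.sum_congr rfl this, Finset.sum_ite_eq']
  split_ifs with h
  · rfl
  · rw [notMem_support_iff.mp h, map_zero]

theorem frobCoeff_add (hq : 0 < q) (b : Fin 4 →₀ ℕ) (f g : MvPolynomial (Fin 4) F) :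
    frobCoeff q ρ b (f + g) = frobCoeff q ρ b f + frobCoeff q ρ b g := by
  ext a
  simp only [coeff_frobCoeff q ρ hq, coeff_add, map_add]

theorem frobCoeff_mul_X (hq : 0 < q) (b : Fin 4 →₀ ℕ) (hb : ∀ i, b i < q)
    (u : MvPolynomial (Fin 4) F) (i : Fin 4) :
    frobCoeff q ρ b (u * X i ^ q) = frobCoeff q ρ b u * X i := by
  classical
  ext a
  rw [coeff_frobCoeff q ρ hq, X_pow_eq_monomial, coeff_mul_monomial', coeff_mul_X',
    coeff_frobCoeff q ρ hq]
  have hiff : Finsupp.single i q ≤ b + q • a ↔ i ∈ a.support := by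
    rw [Finsupp.single_le_iff, Finsupp.mem_support_iff]
    simp only [Finsupp.add_apply, Finsupp.smul_apply, smul_eq_mul]
    have := hb i
    constructor
    · intro h h0
      rw [h0] at h; omega
    · intro h
      have : q * 1 ≤ q * a i := Nat.mul_le_mul_left _ (by omega)
      omega
  by_cases h : i ∈ a.support
  · rw [if_pos (hiff.mpr h), if_pos h, mul_one]
    congr 2
    ext j
    simp only [Finsupp.tsub_apply, Finsupp.add_apply, Finsupp.smul_apply, smul_eq_mul,
      Nat.mul_sub]
    by_cases hj : i = j
    · subst hj
      have h' := Finsupp.mem_support_iff.mp h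
      have : q * 1 ≤ q * a i := Nat.mul_le_mul_left _ (by omega)
      simp
      omega
    · simp [Finsupp.single_eq_of_ne' hj]
  · rw [if_neg (fun h' => h (hiff.mp h')), if_neg h, map_zero]

theorem frobCoeff_mul_pow (p e : ℕ) [Fact p.Prime] [CharP F p] (hqe : q = p ^ e)
    (hρ : ∀ x, ρ (x ^ q) = x) (b : Fin 4 →₀ ℕ) (hb : ∀ i, b i < q)
    (v u : MvPolynomial (Fin 4) F) :
    frobCoeff q ρ b (u * v ^ q) = frobCoeff q ρ b u * v := by
  have hq : 0 < q := by rw [hqe]; exact pow_pos (Fact.out : p.Prime).pos e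
  induction v using MvPolynomial.induction_on generalizing u with
  | C c =>
    ext a
    rw [coeff_frobCoeff q ρ hq, ← C_pow, mul_comm u, mul_comm _ (C c), coeff_C_mul, coeff_C_mul,
      coeff_frobCoeff q ρ hq, map_mul, hρ]
  | add v w hv hw =>
    have : (v + w) ^ q = v ^ q + w ^ q := by
      rw [hqe]; exact add_pow_char_pow v w p e
    rw [this, mul_add, frobCoeff_add q ρ hq, hv, hw, mul_add]
  | mul_X v i hv =>
    rw [mul_pow, ← mul_assoc, mul_right_comm, hv, frobCoeff_mul_X q ρ hq b hb]
    ring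

theorem frobCoeff_ne_zero (hq : 0 < q) (h : MvPolynomial (Fin 4) F) (hh : h ≠ 0) :
    ∃ b : Fin 4 →₀ ℕ, (∀ i, b i < q) ∧ frobCoeff q ρ b h ≠ 0 := by
  obtain ⟨c, hc⟩ := exists_coeff_ne_zero hh
  refine ⟨Finsupp.equivFunOnFinite.symm (fun i => c i % q), fun i => Nat.mod_lt _ hq, ?_⟩
  intro h0
  have := coeff_frobCoeff q ρ hq (Finsupp.equivFunOnFinite.symm (fun i => c i % q))
    (Finsupp.equivFunOnFinite.symm (fun i => c i / q)) h
  rw [h0, coeff_zero] at this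
  have e : (Finsupp.equivFunOnFinite.symm (fun i => c i % q)) +
    q • (Finsupp.equivFunOnFinite.symm (fun i => c i / q)) = c := by
    ext i
    simp [Nat.mod_add_div]
  rw [e] at this
  exact hc ((map_eq_zero ρ).mp this.symm)

theorem frobCoeff_homogeneous (hq : 0 < q) (b : Fin 4 →₀ ℕ) (h : MvPolynomial (Fin 4) F) (D : ℕ)
    (hD : h.IsHomogeneous D) (h0 : frobCoeff q ρ b h ≠ 0) :
    ∃ s, q * s ≤ D ∧ (frobCoeff q ρ b h).IsHomogeneous s := by
  have key : ∀ a, coeff a (frobCoeff q ρ b h) ≠ 0 → b.degree + q * a.degree = D := by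
    intro a ha
    rw [coeff_frobCoeff q ρ hq] at ha
    have h1 : coeff (b + q • a) h ≠ 0 := fun h => ha (by rw [h, map_zero])
    by_contra hne
    apply h1
    apply hD.coeff_eq_zero
    rwa [map_add, map_nsmul, smul_eq_mul]
  obtain ⟨a, ha⟩ := exists_coeff_ne_zero h0
  refine ⟨a.degree, by have := key a ha; omega, ?_⟩
  intro a' ha'
  have h1 := key a ha
  have h2 := key a' ha'
  have h3 : q * a'.degree = q * a.degree := by omega
  have h4 := Nat.eq_of_mul_eq_mul_left hq h3
  rw [← h4, Finsupp.degree_eq_weight_one]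
  rfl

theorem shiftBy_neg (P : Fin 4 → F) (f : MvPolynomial (Fin 4) F) :
    shiftBy (fun i => - P i) (shiftBy P f) = f := by
  have : (shiftBy (fun i => - P i)).comp (shiftBy P) = AlgHom.id F _ := by
    ext i : 1
    simp [shiftBy]
  exact congrArg (fun φ : MvPolynomial (Fin 4) F →ₐ[F] MvPolynomial (Fin 4) F => φ f) this

theorem shiftBy_neg' (P : Fin 4 → F) (f : MvPolynomial (Fin 4) F) :
    shiftBy P (shiftBy (fun i => - P i) f) = f := by
  have : (shiftBy P).comp (shiftBy (fun i => - P i)) = AlgHom.id F _ := by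
    ext i : 1
    simp [shiftBy]
  exact congrArg (fun φ : MvPolynomial (Fin 4) F →ₐ[F] MvPolynomial (Fin 4) F => φ f) this

theorem frobCoeff_vanOrd (p e : ℕ) [Fact p.Prime] [CharP F p] (hqe : q = p ^ e)
    (hρ : ∀ x, ρ (x ^ q) = x) (b : Fin 4 →₀ ℕ) (hb : ∀ i, b i < q) (P : Fin 4 → F) (m : ℕ)
    (h : MvPolynomial (Fin 4) F) (hv : VanOrd P (q * (m + 3)) h) :
    VanOrd P m (frobCoeff q ρ b h) := by
  classical
  have hq : 0 < q := by rw [hqe]; exact pow_pos (Fact.out : p.Prime).pos e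
  unfold VanOrd at hv
  rw [mem_pow_idealOfVars_iff] at hv
  set g := shiftBy P h with hg
  have hh : h = ∑ c ∈ g.support, shiftBy (fun i => - P i) (monomial c (coeff c g)) := by
    rw [← map_sum, ← as_sum g, hg, shiftBy_neg]
  let A : MvPolynomial (Fin 4) F →+ MvPolynomial (Fin 4) F :=
    AddMonoidHom.mk' (frobCoeff q ρ b) (frobCoeff_add q ρ hq b)
  have hA : frobCoeff q ρ b h =
      ∑ c ∈ g.support, frobCoeff q ρ b (shiftBy (fun i => - P i) (monomial c (coeff c g))) := by
    conv_lhs => rw [hh]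
    exact map_sum A _ _
  rw [hA]
  unfold VanOrd
  rw [map_sum]
  refine Ideal.sum_mem _ fun c hc => ?_
  let cr : Fin 4 →₀ ℕ := Finsupp.equivFunOnFinite.symm (fun i => c i % q)
  let cd : Fin 4 →₀ ℕ := Finsupp.equivFunOnFinite.symm (fun i => c i / q)
  have ec : cr + q • cd = c := by
    ext i
    simp [cr, cd, Nat.mod_add_div]
  have e1 : monomial c (coeff c g) = monomial cr (coeff c g) * (monomial cd (1 : F)) ^ q := by
    rw [monomial_pow, monomial_mul, ec]; simp
  rw [e1, map_mul, map_pow, frobCoeff_mul_pow q ρ p e hqe hρ b hb, map_mul, shiftBy_neg']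
  refine Ideal.mul_mem_left _ _ ?_
  rw [monomial_mem_pow_idealOfVars_iff _ _ one_ne_zero]
  have h1 := hv c hc
  rw [← ec, map_add, map_nsmul, smul_eq_mul] at h1
  have h2 : cr.degree + 4 ≤ 4 * q := by
    have hc : ∀ i, cr i + 1 ≤ q := fun i => Nat.mod_lt _ hq
    rw [Finsupp.degree_eq_sum, Fin.sum_univ_four]
    have := hc 0; have := hc 1; have := hc 2; have := hc 3
    omega
  by_contra hlt
  have h3 : q * (cd.degree + 1) ≤ q * m := Nat.mul_le_mul_left _ (by omega)
  rw [mul_add] at h1 h3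
  omega

end Frob

theorem charp_bound {F : Type*} [Field F] (p : ℕ) [Fact p.Prime] [CharP F p] [PerfectRing F p]
    {n : ℕ} (P : Fin n → Fin 4 → F) (m₀ T : ℕ) (hP : NoForm P m₀ T) (t m : ℕ) (hm : 1 ≤ m)
    (f : MvPolynomial (Fin 4) F) (hf : f.IsHomogeneous t) (hf0 : f ≠ 0)
    (hv : ∀ j, VanOrd (P j) m f) : m * (T + 1) ≤ t * (m₀ + 3) := by
  obtain ⟨q, hqe⟩ : ∃ q, q = p ^ (t * m) := ⟨_, rfl⟩
  have hq : t * m < q := hqe ▸ Nat.lt_pow_self (Fact.out : p.Prime).one_lt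
  let ρ : F →+* F := (iterateFrobeniusEquiv F p (t * m)).symm.toRingHom
  have hρ : ∀ x, ρ (x ^ q) = x := by
    intro x
    change (iterateFrobeniusEquiv F p (t * m)).symm (x ^ q) = x
    rw [RingEquiv.symm_apply_eq, iterateFrobeniusEquiv_def, hqe]
  obtain ⟨r, hr⟩ : ∃ r, r = q * (m₀ + 3) / m + 1 := ⟨_, rfl⟩
  have hr1 : q * (m₀ + 3) ≤ m * r := by
    have := Nat.div_add_mod (q * (m₀ + 3)) m
    have := Nat.mod_lt (q * (m₀ + 3)) hm
    rw [hr, mul_add m]; omega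
  have hr2 : m * r ≤ q * (m₀ + 3) + m := by
    have := Nat.mul_div_le (q * (m₀ + 3)) m
    rw [hr, mul_add m]; omega
  have hv' : ∀ j, VanOrd (P j) (q * (m₀ + 3)) (f ^ r) := fun j => ((hv j).pow r).mono hr1
  obtain ⟨b, hb, hb0⟩ := frobCoeff_ne_zero q ρ (by omega) (f ^ r) (pow_ne_zero _ hf0)
  obtain ⟨s, hs, hhom⟩ := frobCoeff_homogeneous q ρ (by omega) b (f ^ r) _ (hf.pow r) hb0
  have hvan : ∀ j, VanOrd (P j) m₀ (frobCoeff q ρ b (f ^ r)) := fun j =>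
    frobCoeff_vanOrd q ρ p (t * m) hqe hρ b hb (P j) m₀ _ (hv' j)
  have hTs : T + 1 ≤ s := by
    by_contra hlt
    have h1 := hP (X 0 ^ (T - s) * frobCoeff q ρ b (f ^ r)) (by
      have := (isHomogeneous_X_pow (R := F) (0 : Fin 4) (T - s)).mul hhom
      rwa [Nat.sub_add_cancel (by omega)] at this) (fun j => (hvan j).mul_left _)
    rcases mul_eq_zero.mp h1 with h | h
    · exact pow_ne_zero _ (X_ne_zero 0) h
    · exact hb0 h
  have h1 : q * (T + 1) ≤ t * r := (Nat.mul_le_mul_left _ hTs).trans hs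
  have h2 : q * (m * (T + 1)) < q * (t * (m₀ + 3) + 1) := by
    have e1 : m * (q * (T + 1)) ≤ m * (t * r) := Nat.mul_le_mul_left _ h1
    have e2 : t * (m * r) ≤ t * (q * (m₀ + 3) + m) := Nat.mul_le_mul_left _ hr2
    nlinarith
  have := Nat.lt_of_mul_lt_mul_left h2
  omega

/-! ### Specialization to positive characteristic -/

theorem isJacobsonRing_int : IsJacobsonRing ℤ := by
  rw [isJacobsonRing_iff_prime_eq]
  intro P hP
  by_cases h : P = ⊥
  · subst h
    rw [eq_bot_iff]
    intro x hx
    have := Ideal.mem_jacobson_bot.mp hx x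
    rw [Int.isUnit_iff] at this
    rw [Ideal.mem_bot]
    rcases this with h | h
    · have : x * x = 0 := by omega
      simpa using this
    · nlinarith [mul_self_nonneg x]
  · have := IsPrime.to_maximal_ideal h
    exact Ideal.jacobson_eq_self_of_isMaximal

theorem exists_perfect.{u} (K : Type u) [Field K] (p : ℕ) [Fact p.Prime] [CharP K p] :
    ∃ (F : Type u) (_ : Field F) (_ : CharP F p) (_ : PerfectRing F p), Nonempty (K →+* F) :=
  ⟨AlgebraicClosure K, inferInstance,
    charP_of_injective_algebraMap (algebraMap K _).injective p,
    PerfectField.toPerfectRing p, ⟨algebraMap _ _⟩⟩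

theorem exists_charp.{u} {k : Type u} [Field k] (s : Finset k) :
    ∃ (p : ℕ) (_ : Fact p.Prime) (F : Type u) (_ : Field F) (_ : CharP F p) (_ : PerfectRing F p),
      Nonempty (Algebra.adjoin ℤ (s : Set k) →+* F) := by
  obtain ⟨M, hM⟩ := Ideal.exists_maximal (Algebra.adjoin ℤ (s : Set k))
  let _ : Field (Algebra.adjoin ℤ (s : Set k) ⧸ M) := Ideal.Quotient.field M
  have h1 : Algebra.FiniteType ℤ (Algebra.adjoin ℤ (s : Set k)) :=
    (Subalgebra.fg_iff_finiteType _).mp ⟨s, rfl⟩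
  have h2 : Algebra.FiniteType ℤ (Algebra.adjoin ℤ (s : Set k) ⧸ M) :=
    Algebra.FiniteType.of_surjective (Ideal.Quotient.mkₐ ℤ M) (Ideal.Quotient.mkₐ_surjective ℤ M)
  have := isJacobsonRing_int
  have h3 := finite_of_finite_type_of_isJacobsonRing ℤ (Algebra.adjoin ℤ (s : Set k) ⧸ M)
  obtain ⟨p, hp⟩ := CharP.exists (Algebra.adjoin ℤ (s : Set k) ⧸ M)
  rcases CharP.char_is_prime_or_zero (Algebra.adjoin ℤ (s : Set k) ⧸ M) p with h | h
  · have hpp : Fact p.Prime := ⟨h⟩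
    obtain ⟨F, i1, i2, i3, ⟨ψ⟩⟩ := exists_perfect (Algebra.adjoin ℤ (s : Set k) ⧸ M) p
    exact ⟨p, hpp, F, i1, i2, i3, ⟨ψ.comp (Ideal.Quotient.mk M)⟩⟩
  · exfalso
    subst h
    have : CharZero (Algebra.adjoin ℤ (s : Set k) ⧸ M) := CharP.charP_to_charZero _
    have hinj : Function.Injective (algebraMap ℤ (Algebra.adjoin ℤ (s : Set k) ⧸ M)) :=
      RingHom.injective_int _
    have := isField_of_isIntegral_of_isField hinj (Field.toIsField _)
    exact Int.not_isField this

/-! ### The Gram determinant -/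

section Gram

variable (m T : ℕ)

/-- Exponents of degree `T`. -/
abbrev GCol := {a : Fin 4 →₀ ℕ // a.degree = T}

/-- Exponents of degree less than `m`, for each point. -/
abbrev GRow (n : ℕ) := Fin n × {b : Fin 4 →₀ ℕ // b.degree < m}

noncomputable instance : Fintype (GCol T) :=
  ((Finsupp.finite_of_degree_le (σ := Fin 4) T).subset
    (fun a (ha : a.degree = T) => ha.le)).fintype

noncomputable instance : Fintype {b : Fin 4 →₀ ℕ // b.degree < m} :=
  ((Finsupp.finite_of_degree_le (σ := Fin 4) m).subset
    (fun b (hb : b.degree < m) => hb.le)).fintype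

noncomputable instance : DecidableEq (GCol T) := Classical.decEq _

/-- The matrix of the linear conditions imposed by the fat points. -/
noncomputable def gMat {S : Type*} [CommRing S] {n : ℕ} (P : Fin n → Fin 4 → S) :
    Matrix (GRow m n) (GCol T) S :=
  Matrix.of fun r c => coeff r.2.1 (shiftBy (P r.1) (monomial c.1 1))

/-- The determinant of the Gram matrix. -/
noncomputable def gDet {S : Type*} [CommRing S] {n : ℕ} (P : Fin n → Fin 4 → S) : S :=
  ((gMat m T P).transpose * gMat m T P).det

theorem gDet_map {S S' : Type*} [CommRing S] [CommRing S'] {n : ℕ} (φ : S →+* S')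
    (P : Fin n → Fin 4 → S) : gDet m T (fun j i => φ (P j i)) = φ (gDet m T P) := by
  unfold gDet
  rw [RingHom.map_det]
  have : gMat m T (fun j i => φ (P j i)) = (gMat m T P).map φ := by
    ext r c
    simp only [gMat, Matrix.of_apply, Matrix.map_apply]
    rw [← coeff_map, ← shiftBy_map, map_monomial, map_one φ]
  rw [this]
  congr 1
  rw [RingHom.mapMatrix_apply, Matrix.map_mul, Matrix.transpose_map]

theorem gMat_mulVec {S : Type*} [CommRing S] {n : ℕ} (P : Fin n → Fin 4 → S) (c : GCol T → S)
    (r : GRow m n) : (gMat m T P).mulVec c r =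
      coeff r.2.1 (shiftBy (P r.1) (∑ a, monomial a.1 (c a))) := by
  rw [map_sum, coeff_sum]
  simp only [Matrix.mulVec, dotProduct, gMat, Matrix.of_apply]
  refine Finset.sum_congr rfl fun a _ => ?_
  have : monomial a.1 (c a) = C (c a) * monomial a.1 1 := by
    rw [C_mul_monomial, mul_one]
  rw [this, map_mul]
  have h2 : shiftBy (P r.1) (C (c a)) = C (c a) := by simp [shiftBy]
  rw [h2, coeff_C_mul, mul_comm]

theorem coeff_sum_col {S : Type*} [CommRing S] (c : GCol T → S) (b : GCol T) :
    coeff b.1 (∑ a : GCol T, monomial a.1 (c a)) = c b := by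
  classical
  rw [coeff_sum]
  simp only [coeff_monomial]
  rw [Finset.sum_eq_single b]
  · simp
  · intro a _ hab
    rw [if_neg]
    intro h; exact hab (Subtype.ext h)
  · simp

theorem noForm_of_gDet {S : Type*} [CommRing S] [IsDomain S] {n : ℕ} (P : Fin n → Fin 4 → S)
    (h : gDet m T P ≠ 0) : NoForm P m T := by
  intro f hf hv
  by_contra hf0
  apply h
  unfold gDet
  rw [← Matrix.exists_mulVec_eq_zero_iff]
  have hsum : ∑ a : GCol T, monomial a.1 (coeff a.1 f) = f := by
    ext b
    by_cases hb : b.degree = T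
    · exact coeff_sum_col T (fun a => coeff a.1 f) ⟨b, hb⟩
    · rw [hf.coeff_eq_zero hb, coeff_sum]
      refine Finset.sum_eq_zero fun a _ => ?_
      classical
      rw [coeff_monomial, if_neg]
      intro h
      exact hb (h ▸ a.2)
  refine ⟨fun a => coeff a.1 f, ?_, ?_⟩
  · intro h0
    apply hf0
    rw [← hsum]
    refine Finset.sum_eq_zero fun a _ => ?_
    have := congrFun h0 a
    simp only [Pi.zero_apply] at this
    rw [this, map_zero]
  · rw [← Matrix.mulVec_mulVec]
    have : (gMat m T P).mulVec (fun a => coeff a.1 f) = 0 := by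
      ext r
      rw [gMat_mulVec, hsum]
      exact (mem_pow_idealOfVars_iff' _ _).mp (hv r.1) _ r.2.2
    rw [this, Matrix.mulVec_zero]

theorem gDet_of_noForm {n : ℕ} (P : Fin n → Fin 4 → ℚ) (h : NoForm P m T) :
    gDet m T P ≠ 0 := by
  unfold gDet
  intro h0
  rw [← Matrix.exists_mulVec_eq_zero_iff] at h0
  obtain ⟨c, hc0, hc⟩ := h0
  rw [← Matrix.mulVec_mulVec] at hc
  have h1 : (gMat m T P).mulVec c = 0 := by
    rw [← dotProduct_self_eq_zero]
    have := congrArg (fun v => c ⬝ᵥ v) hc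
    simp only [dotProduct_zero] at this
    rwa [Matrix.dotProduct_mulVec, Matrix.vecMul_transpose] at this
  apply hc0
  have h2 := h (∑ a : GCol T, monomial a.1 (c a)) (IsHomogeneous.sum _ _ _ fun a _ =>
    isHomogeneous_monomial _ a.2) (by
      intro j
      unfold VanOrd
      rw [mem_pow_idealOfVars_iff']
      intro x hx
      have := congrFun h1 (j, ⟨x, hx⟩)
      rwa [gMat_mulVec] at this)
  funext b
  rw [← coeff_sum_col T c b, h2, coeff_zero, Pi.zero_apply]

end Gram

theorem char0_bound {k : Type*} [Field k] {n : ℕ} (P : Fin n → Fin 4 → k)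
    (m₀ T : ℕ) (hP : gDet m₀ T P ≠ 0) (t m : ℕ) (hm : 1 ≤ m)
    (f : MvPolynomial (Fin 4) k) (hf : f.IsHomogeneous t) (hf0 : f ≠ 0)
    (hv : ∀ j, VanOrd (P j) m f) : m * (T + 1) ≤ t * (m₀ + 3) := by
  classical
  obtain ⟨c, hc⟩ := exists_coeff_ne_zero hf0
  let s : Finset k := f.support.image (fun a => coeff a f) ∪
    Finset.univ.image (fun x : Fin n × Fin 4 => P x.1 x.2) ∪
    {(gDet m₀ T P)⁻¹, (coeff c f)⁻¹}
  obtain ⟨p, hp, F, _, _, _, ⟨φ⟩⟩ := exists_charp s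
  let A := Algebra.adjoin ℤ (s : Set k)
  have hs : ∀ x ∈ s, x ∈ A := fun x hx => Algebra.subset_adjoin hx
  obtain ⟨f', hf'⟩ : ∃ f' : MvPolynomial (Fin 4) A, map A.val.toRingHom f' = f := by
    have : f ∈ Set.range (map A.val.toRingHom : MvPolynomial (Fin 4) A → _) := by
      rw [mem_range_map_iff_coeffs_subset]
      intro x hx
      rw [SetLike.mem_coe, mem_coeffs_iff] at hx
      obtain ⟨a, ha, rfl⟩ := hx
      refine ⟨⟨coeff a f, hs _ ?_⟩, rfl⟩
      simp only [s, Finset.mem_union, Finset.mem_image]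
      exact Or.inl (Or.inl ⟨a, ha, rfl⟩)
    exact this
  let P' : Fin n → Fin 4 → A := fun j i => ⟨P j i, hs _ (by
    simp only [s, Finset.mem_union, Finset.mem_image]
    exact Or.inl (Or.inr ⟨(j, i), Finset.mem_univ _, rfl⟩))⟩
  have hinj : Function.Injective A.val.toRingHom := Subtype.val_injective
  have hunit : ∀ (x : A), (x : k) ≠ 0 → (x : k)⁻¹ ∈ s → φ x ≠ 0 := by
    intro x hx hxs h0
    have : x * ⟨(x : k)⁻¹, hs _ hxs⟩ = 1 := Subtype.ext (mul_inv_cancel₀ hx)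
    have h2 := congrArg φ this
    rw [map_mul, h0, zero_mul, map_one] at h2
    exact zero_ne_one h2
  have hg : ((gDet m₀ T P' : A) : k) = gDet m₀ T P := (gDet_map m₀ T A.val.toRingHom P').symm
  have hcf : ((coeff c f' : A) : k) = coeff c f := by
    rw [← hf', coeff_map]; rfl
  refine charp_bound p (fun j i => φ (P' j i)) m₀ T ?_ t m hm (map φ f') ?_ ?_ ?_
  · apply noForm_of_gDet
    rw [gDet_map]
    apply hunit
    · rw [hg]; exact hP
    · rw [hg]; simp [s]
  · apply IsHomogeneous.map
    apply IsHomogeneous.of_map hinj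
    rw [hf']; exact hf
  · intro h0
    have := congrArg (coeff c) h0
    rw [coeff_map, coeff_zero] at this
    refine hunit (coeff c f') ?_ ?_ this
    · rw [hcf]; exact hc
    · rw [hcf]; simp [s]
  · intro j
    apply VanOrd.map
    apply VanOrd.of_map A.val.toRingHom hinj
    rw [hf']; exact hv j

/-! ### Dimension count -/

theorem card_gcol (d : ℕ) : Fintype.card (GCol d) = (d + 3).choose 3 := by
  classical
  have h := Finset.card_finsuppAntidiag_nat_eq_choose (s := (Finset.univ : Finset (Fin 4))) d
  rw [Fintype.card_of_subtype (Finset.finsuppAntidiag (Finset.univ : Finset (Fin 4)) d), h]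
  · rw [Finset.card_univ, Fintype.card_fin, show 4 + d - 1 = d + 3 by omega,
      Nat.choose_symm_add]
  · intro x
    rw [Finset.mem_finsuppAntidiag, Finsupp.degree_eq_sum]
    simp

theorem hom_degree {k : Type*} [Field k] {h : MvPolynomial (Fin 4) k} {t : ℕ}
    (hh : h.IsHomogeneous t) {a : Fin 4 →₀ ℕ} (ha : coeff a h ≠ 0) : a.degree = t := by
  by_contra hne
  exact ha (hh.coeff_eq_zero hne)

theorem exists_form {k : Type*} [Field k] {n d : ℕ} (p : Fin n → Fin 4 → k)
    (hn : n < (d + 3).choose 3) :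
    ∃ g : MvPolynomial (Fin 4) k, g ≠ 0 ∧ g.IsHomogeneous d ∧ ∀ j, eval (p j) g = 0 := by
  let L : (GCol d → k) →ₗ[k] (Fin n → k) := LinearMap.pi fun j =>
    ∑ a : GCol d, (LinearMap.proj a).smulRight (eval (p j) (monomial a.1 1))
  have hker : LinearMap.ker L ≠ ⊥ := by
    apply LinearMap.ker_ne_bot_of_finrank_lt
    rw [Module.finrank_fintype_fun_eq_card, Module.finrank_fintype_fun_eq_card, card_gcol]
    simpa using hn
  obtain ⟨c, hc, hc0⟩ := (Submodule.ne_bot_iff _).mp hker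
  refine ⟨∑ a : GCol d, monomial a.1 (c a), ?_, ?_, ?_⟩
  · intro h0
    apply hc0
    funext b
    rw [← coeff_sum_col d c b, h0, coeff_zero, Pi.zero_apply]
  · exact IsHomogeneous.sum _ _ _ fun a _ => isHomogeneous_monomial _ a.2
  · intro j
    have := congrFun (LinearMap.mem_ker.mp hc) j
    simp only [L, LinearMap.pi_apply, LinearMap.sum_apply, LinearMap.smulRight_apply,
      LinearMap.proj_apply, Pi.zero_apply] at this
    rw [map_sum, ← this]
    refine Finset.sum_congr rfl fun a _ => ?_
    simp [eval_monomial]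

theorem alpha_bound {k : Type*} [Field k] {n d : ℕ} (p : Fin n → Fin 4 → k)
    (hn : n < (d + 3).choose 3)
    (h : ∀ t m : ℕ, 1 ≤ m → ∀ f : MvPolynomial (Fin 4) k, f.IsHomogeneous t → f ≠ 0 →
      (∀ j, VanOrd (p j) m f) → m * (d + 2) ≤ 3 * t) (m : ℕ) (hm : 1 ≤ m) :
    (m : ℝ) * ((alpha (fatIdeal (N := 3) p (fun _ => 1)) : ℝ) + 2) / 3 ≤
          (alpha (fatIdeal (N := 3) p (fun _ => m)) : ℝ) := by
  obtain ⟨g, hg0, hgd, hg⟩ := exists_form p hn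
  have hmem : ∀ j, g ∈ pointIdeal (p j) := fun j => Ideal.subset_span ⟨⟨d, hgd⟩, hg j⟩
  have h1 : alpha (fatIdeal (N := 3) p (fun _ => 1)) ≤ d := by
    apply Nat.sInf_le
    refine ⟨g, ?_, hg0, hgd⟩
    simp only [fatIdeal, pow_one, Ideal.mem_iInf]
    exact hmem
  have h2 : alpha (fatIdeal (N := 3) p (fun _ => m)) ∈
      { t | ∃ f ∈ fatIdeal (N := 3) p (fun _ => m), f ≠ 0 ∧ f.IsHomogeneous t } := by
    apply Nat.sInf_mem
    refine ⟨d * m, g ^ m, ?_, pow_ne_zero _ hg0, hgd.pow m⟩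
    simp only [fatIdeal, Ideal.mem_iInf]
    exact fun j => Ideal.pow_mem_pow (hmem j) m
  obtain ⟨f, hf, hf0, hft⟩ := h2
  simp only [fatIdeal, Ideal.mem_iInf] at hf
  have h3 := h _ m hm f hft hf0 fun j => vanOrd_of_mem _ _ _ (hf j)
  have h4 : (m : ℝ) * (d + 2) ≤ 3 * (alpha (fatIdeal (N := 3) p (fun _ => m)) : ℝ) := by
    exact_mod_cast h3
  have h5 : (alpha (fatIdeal (N := 3) p (fun _ => 1)) : ℝ) ≤ d := by exact_mod_cast h1
  have h6 : (m : ℝ) * ((alpha (fatIdeal (N := 3) p (fun _ => 1)) : ℝ) + 2) ≤ m * (d + 2) := by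
    gcongr
  linarith

/-! ### The case of one to three points -/

theorem bound_one {k : Type*} [Field k] (P : Fin 4 → k) (t m : ℕ)
    (f : MvPolynomial (Fin 4) k) (hf : f.IsHomogeneous t) (hf0 : f ≠ 0) (hv : VanOrd P m f) :
    m ≤ t := by
  by_contra h
  apply hf0
  exact vanOrd_zero_of_lt P m f (by rw [hf.totalDegree hf0]; omega) hv

/-! ### Four independent points -/

theorem exponent_bound {k : Type*} [Field k] (i : Fin 4) (t m : ℕ)
    (h : MvPolynomial (Fin 4) k) (hh : h.IsHomogeneous t) (hv : VanOrd (Pi.single i 1) m h)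
    (a : Fin 4 →₀ ℕ) (ha : coeff a h ≠ 0) : m + a i ≤ t := by
  classical
  let χ : MvPolynomial (Fin 4) k →ₐ[k] MvPolynomial (Fin 4) k :=
    aeval fun j => if j = i then 1 else X j
  let ψ : MvPolynomial (Fin 4) k →ₐ[k] MvPolynomial (Fin 4) k :=
    aeval fun j => if j = i then 0 else X j
  have h1 : χ = ψ.comp (shiftBy (Pi.single i 1)) := by
    apply algHom_ext
    intro j
    by_cases hj : j = i
    · subst hj; simp [χ, ψ, shiftBy]
    · simp [χ, ψ, shiftBy, hj]
  have h2 : (idealOfVars (Fin 4) k).map ψ ≤ idealOfVars (Fin 4) k := by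
    unfold idealOfVars
    rw [Ideal.map_span, Ideal.span_le]
    rintro _ ⟨_, ⟨j, rfl⟩, rfl⟩
    by_cases hj : j = i
    · simp [ψ, hj]
    · simp only [ψ, aeval_X, hj, if_false]
      exact Ideal.subset_span ⟨j, rfl⟩
  have h3 : χ h ∈ idealOfVars (Fin 4) k ^ m := by
    rw [h1, AlgHom.comp_apply]
    have := Ideal.mem_map_of_mem ψ hv
    rw [Ideal.map_pow] at this
    exact Ideal.pow_right_mono h2 m this
  have hmon : ∀ (b : Fin 4 →₀ ℕ) (c : k), χ (monomial b c) = monomial (b.erase i) c := by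
    intro b c
    rw [aeval_monomial, monomial_eq, algebraMap_eq]
    congr 1
    rw [Finsupp.prod_fintype _ _ (by simp), Finsupp.prod_fintype _ _ (by simp)]
    refine Finset.prod_congr rfl fun j _ => ?_
    by_cases hj : j = i
    · subst hj; simp
    · simp [hj, Finsupp.erase_ne]
  have hdeg : ∀ b : Fin 4 →₀ ℕ, (b.erase i).degree + b i = b.degree := by
    intro b
    conv_rhs => rw [← Finsupp.erase_add_single i b]
    rw [map_add, Finsupp.degree_single]
  have h4 : coeff (a.erase i) (χ h) = coeff a h := by
    conv_lhs => rw [h.as_sum]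
    rw [map_sum, coeff_sum]
    rw [Finset.sum_eq_single a]
    · rw [hmon, coeff_monomial, if_pos rfl]
    · intro b hb hba
      rw [hmon, coeff_monomial, if_neg]
      intro he
      apply hba
      have e1 := hom_degree hh ha
      have e2 := hom_degree hh (mem_support_iff.mp hb)
      have e3 := hdeg a
      have e4 := hdeg b
      rw [he] at e4
      rw [← Finsupp.erase_add_single i b, ← Finsupp.erase_add_single i a, he]
      congr 2
      omega
    · intro hn
      exact absurd (mem_support_iff.mpr ha) hn
  have h5 : ¬ (a.erase i).degree < m := fun hlt => by
    apply ha
    rw [← h4]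
    exact (mem_pow_idealOfVars_iff' _ _).mp h3 _ hlt
  have e1 := hom_degree hh ha
  have e3 := hdeg a
  omega

theorem bound_four {k : Type*} [Field k] (q : Fin 4 → Fin 4 → k) (hq : (Matrix.of q).det ≠ 0)
    (t m : ℕ) (f : MvPolynomial (Fin 4) k) (hf : f.IsHomogeneous t) (hf0 : f ≠ 0)
    (hv : ∀ j, VanOrd (q j) m f) : 4 * m ≤ 3 * t := by
  classical
  let A : Matrix (Fin 4) (Fin 4) k := Matrix.of q
  let φ : MvPolynomial (Fin 4) k →ₐ[k] MvPolynomial (Fin 4) k :=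
    aeval fun l => ∑ i, C (A i l) * X i
  let ψ : MvPolynomial (Fin 4) k →ₐ[k] MvPolynomial (Fin 4) k :=
    aeval fun i => ∑ l, C (A⁻¹ l i) * X l
  have hcomp : ψ.comp φ = AlgHom.id k _ := by
    apply algHom_ext
    intro l
    have hA : A⁻¹ * A = 1 := Matrix.nonsing_inv_mul A (isUnit_iff_ne_zero.mpr hq)
    have e : ψ (φ (X l)) = ∑ l', C ((A⁻¹ * A) l' l) * X l' := by
      simp only [φ, ψ, aeval_X, map_sum, map_mul, algHom_C, algebraMap_eq, Matrix.mul_apply,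
        Finset.sum_mul, Finset.mul_sum]
      rw [Finset.sum_comm]
      refine Finset.sum_congr rfl fun x _ => Finset.sum_congr rfl fun y _ => ?_
      ring
    rw [AlgHom.comp_apply, e, hA]
    simp [Matrix.one_apply]
  have hinj : Function.Injective φ := by
    intro x y hxy
    have := congrArg ψ hxy
    rwa [← AlgHom.comp_apply, ← AlgHom.comp_apply, hcomp] at this
  have hφ0 : φ f ≠ 0 := fun h0 => hf0 (hinj (by rw [h0, map_zero]))
  have hφh : (φ f).IsHomogeneous t := by
    have := hf.aeval (fun l => ∑ i, C (A i l) * X i : Fin 4 → MvPolynomial (Fin 4) k) (n := 1)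
      (fun l => IsHomogeneous.sum _ _ _ fun i _ => isHomogeneous_C_mul_X _ _)
    rw [one_mul] at this
    exact this
  have hφv : ∀ i, VanOrd (Pi.single i 1) m (φ f) := by
    intro i
    have h1 : (shiftBy (Pi.single i 1)).comp φ = φ.comp (shiftBy (q i)) := by
      apply algHom_ext
      intro l
      simp [φ, shiftBy, mul_add, Finset.sum_add_distrib, A, Pi.single_apply]
    have h2 : (idealOfVars (Fin 4) k).map φ ≤ idealOfVars (Fin 4) k := by
      unfold idealOfVars
      rw [Ideal.map_span, Ideal.span_le]
      rintro _ ⟨_, ⟨j, rfl⟩, rfl⟩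
      simp only [φ, aeval_X]
      exact Ideal.sum_mem _ fun i _ => Ideal.mul_mem_left _ _ (Ideal.subset_span ⟨i, rfl⟩)
    have := Ideal.mem_map_of_mem φ (hv i)
    rw [Ideal.map_pow] at this
    have h3 := Ideal.pow_right_mono h2 m this
    unfold VanOrd
    rwa [← AlgHom.comp_apply, h1]
  obtain ⟨a, ha⟩ := exists_coeff_ne_zero hφ0
  have hb := fun i => exponent_bound i t m (φ f) hφh (hφv i) a ha
  have e := hom_degree hφh ha
  rw [Finsupp.degree_eq_sum, Fin.sum_univ_four] at e
  have := hb 0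
  have := hb 1
  have := hb 2
  have := hb 3
  omega

/-! ### Generic statements -/

theorem generic_of_config (k : Type*) [Field k] [CharZero k] (n d m₀ T : ℕ)
    (hn : n < (d + 3).choose 3) (hT : (m₀ + 3) * (d + 2) ≤ 3 * (T + 1))
    (hc : ∃ q : Fin n → Fin 3 → ℤ, ∀ f : MvPolynomial (Fin 3) ℚ, f.totalDegree ≤ T →
      (∀ j, VanOrd (fun i => (q j i : ℚ)) m₀ f) → f = 0) :
    Generic k 3 n (fun p =>
      ∀ m : ℕ, 1 ≤ m →
        (m : ℝ) * ((alpha (fatIdeal p (fun _ => 1)) : ℝ) + 2) / 3 ≤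
          (alpha (fatIdeal p (fun _ => m)) : ℝ)) := by
  obtain ⟨q, hq⟩ := hc
  let U : Fin n → Fin 4 → MvPolynomial (Fin n × Fin 4) k := fun j i => X (j, i)
  have hU : ∀ p : Fin n → Fin 4 → k,
      eval (fun q => p q.1 q.2) (gDet m₀ T U) = gDet m₀ T p := by
    intro p
    rw [← gDet_map]
    congr 1
    funext j i
    simp [U]
  refine ⟨{gDet m₀ T U}, ?_, ?_⟩
  · let Q : Fin n → Fin 4 → ℤ := fun j => Fin.cons 1 (q j)
    obtain ⟨p₀, hp₀⟩ : ∃ p₀ : Fin n → Fin 4 → k,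
      p₀ = fun j i => (Int.castRingHom k) (Q j i) := ⟨_, rfl⟩
    refine ⟨p₀, ?_, gDet m₀ T U, rfl, ?_⟩
    · intro j h0
      rw [hp₀] at h0
      have := congrFun h0 0
      simp [Q] at this
    · rw [hU p₀, hp₀, gDet_map]
      have h1 := gDet_of_noForm m₀ T _ (noForm_of_affine q m₀ T hq)
      have h2 : gDet m₀ T Q ≠ 0 := by
        intro h0
        apply h1
        have := gDet_map m₀ T (Int.castRingHom ℚ) Q
        rw [h0, map_zero] at this
        exact this
      simpa using h2
  · rintro p - ⟨f, rfl, hf⟩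
    rw [hU] at hf
    refine alpha_bound (d := d) p hn ?_
    intro t m hm f hft hf0 hv
    have h := char0_bound p m₀ T hf t m hm f hft hf0 hv
    have h1 : (m * (d + 2)) * (m₀ + 3) ≤ (3 * t) * (m₀ + 3) := by
      calc (m * (d + 2)) * (m₀ + 3) = m * ((m₀ + 3) * (d + 2)) := by ring
        _ ≤ m * (3 * (T + 1)) := Nat.mul_le_mul_left _ hT
        _ = 3 * (m * (T + 1)) := by ring
        _ ≤ 3 * (t * (m₀ + 3)) := Nat.mul_le_mul_left _ h
        _ = _ := by ring
    exact Nat.le_of_mul_le_mul_right h1 (by omega)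

theorem generic_grid (k : Type*) [Field k] [CharZero k] (n d K : ℕ)
    (hn : n < (d + 3).choose 3) (hK : K ^ 3 ≤ n) (hd : d + 3 ≤ 3 * K) :
    Generic k 3 n (fun p =>
      ∀ m : ℕ, 1 ≤ m →
        (m : ℝ) * ((alpha (fatIdeal p (fun _ => 1)) : ℝ) + 2) / 3 ≤
          (alpha (fatIdeal p (fun _ => m)) : ℝ)) := by
  have hpos : 0 < K * (3 * (d + 2)) := by
    apply Nat.mul_pos <;> omega
  refine generic_of_config k n d (3 * (d + 2)) (K * (3 * (d + 2)) - 1) hn ?_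
    (exists_config_grid n K _ _ (by omega) hK (by omega))
  rw [Nat.sub_add_cancel hpos]
  nlinarith

theorem generic_one (k : Type*) [Field k] (n : ℕ) (hn1 : 1 ≤ n) (hn : n < 4) :
    Generic k 3 n (fun p =>
      ∀ m : ℕ, 1 ≤ m →
        (m : ℝ) * ((alpha (fatIdeal p (fun _ => 1)) : ℝ) + 2) / 3 ≤
          (alpha (fatIdeal p (fun _ => m)) : ℝ)) := by
  refine ⟨{1}, ⟨fun _ _ => 1, fun _ h => one_ne_zero (congrFun h 0), 1, rfl, by simp⟩, ?_⟩
  rintro p - -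
  refine alpha_bound (d := 1) p (by simpa [Nat.choose] using hn) ?_
  intro t m hm f hft hf0 hv
  have := bound_one (p ⟨0, hn1⟩) t m f hft hf0 (hv _)
  omega

theorem generic_two (k : Type*) [Field k] (n : ℕ) (hn1 : 4 ≤ n) (hn : n < 10) :
    Generic k 3 n (fun p =>
      ∀ m : ℕ, 1 ≤ m →
        (m : ℝ) * ((alpha (fatIdeal p (fun _ => 1)) : ℝ) + 2) / 3 ≤
          (alpha (fatIdeal p (fun _ => m)) : ℝ)) := by
  classical
  let M : Matrix (Fin 4) (Fin 4) (MvPolynomial (Fin n × Fin 4) k) :=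
    Matrix.of fun i l => X (Fin.castLE hn1 i, l)
  have hM : ∀ p : Fin n → Fin 4 → k,
      eval (fun q => p q.1 q.2) M.det = (Matrix.of fun i => p (Fin.castLE hn1 i)).det := by
    intro p
    rw [RingHom.map_det]
    congr 1
    ext i l
    simp [M]
  refine ⟨{M.det}, ?_, ?_⟩
  · obtain ⟨p₀, hp₀⟩ : ∃ p₀ : Fin n → Fin 4 → k,
      p₀ = fun j => Pi.single (if h : j.1 < 4 then ⟨j.1, h⟩ else 0) 1 := ⟨_, rfl⟩
    refine ⟨p₀, ?_, M.det, rfl, ?_⟩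
    · intro j h0
      rw [hp₀] at h0
      have := congrFun h0 (if h : j.1 < 4 then ⟨j.1, h⟩ else 0)
      simp at this
    · rw [hM p₀, hp₀]
      have : (Matrix.of fun i : Fin 4 => (Pi.single (if h : (Fin.castLE hn1 i).1 < 4 then
          (⟨(Fin.castLE hn1 i).1, h⟩ : Fin 4) else 0) 1 : Fin 4 → k)) = 1 := by
        ext i l
        simp [Pi.single_apply, Matrix.one_apply, eq_comm]
      rw [this, Matrix.det_one]
      exact one_ne_zero
  · rintro p - ⟨f, rfl, hf⟩
    rw [hM] at hf
    refine alpha_bound (d := 2) p (by simpa [Nat.choose] using hn) ?_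
    intro t m hm f hft hf0 hv
    have := bound_four _ hf t m f hft hf0 (fun j => hv _)
    omega

theorem choose_three (d : ℕ) : 6 * (d + 2).choose 3 = (d + 2) * (d + 1) * d := by
  induction d with
  | zero => simp
  | succ d ih =>
    rw [show d + 1 + 2 = (d + 2) + 1 by ring, Nat.choose_succ_succ' (d + 2) 2, mul_add, ih]
    have h2 : 2 * (d + 2).choose 2 = (d + 2) * (d + 1) := by
      rw [Nat.choose_two_right]
      have : 2 ∣ (d + 2) * (d + 2 - 1) := by
        rw [mul_comm]; exact (Nat.even_mul_pred_self (d+2)).two_dvd |> (by rw [mul_comm]; exact ·)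
      rw [Nat.mul_div_cancel' this]
      rfl
    nlinarith

theorem exists_deg (n : ℕ) (hn : 1 ≤ n) :
    ∃ d, 1 ≤ d ∧ (d + 2).choose 3 ≤ n ∧ n < (d + 3).choose 3 := by
  classical
  have hex : ∃ d, n < (d + 3).choose 3 := by
    refine ⟨n, ?_⟩
    have := choose_three (n + 1)
    have h2 : 6 * n < (n + 1 + 2) * (n + 1 + 1) * (n + 1) := by
      ring_nf
      nlinarith [Nat.zero_le (n ^ 2), Nat.zero_le (n ^ 3)]
    have h3 : (n + 3).choose 3 = (n + 1 + 2).choose 3 := rfl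
    omega
  have h := Nat.find_spec hex
  have hmin : ∀ e < Nat.find hex, ¬ n < (e + 3).choose 3 := fun e he => Nat.find_min hex he
  generalize Nat.find hex = d at h hmin
  cases d with
  | zero => simp at h; omega
  | succ d => exact ⟨d + 1, by omega, not_lt.mp (hmin d (by omega)), h⟩

/-- Chudnovsky's Conjecture for generic points in `ℙ³`: for every `n ≥ 1` and points
in general position, `α(I^(m)) ≥ m * (α(I) + 2) / 3` for all `m ≥ 1`. -/
theorem statement2 (k : Type*) [Field k] [CharZero k] (n : ℕ) (hn : 1 ≤ n) :
    Generic k 3 n (fun p =>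
      ∀ m : ℕ, 1 ≤ m →
        (m : ℝ) * ((alpha (fatIdeal p (fun _ => 1)) : ℝ) + 2) / 3 ≤
          (alpha (fatIdeal p (fun _ => m)) : ℝ)) := by
  obtain ⟨d, hd, h1, h2⟩ := exists_deg n hn
  by_cases h7 : 7 ≤ d
  · refine generic_grid k n d ((d + 2) / 3 + 1) h2 ?_ (by omega)
    refine le_trans ?_ h1
    have h3 := choose_three d
    have h4 : 3 * ((d + 2) / 3 + 1) ≤ d + 5 := by omega
    have h5 := Nat.pow_le_pow_left h4 3
    rw [mul_pow] at h5
    obtain ⟨e, rfl⟩ := Nat.exists_eq_add_of_le h7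
    have h6 : 2 * (7 + e + 5) ^ 3 ≤ 9 * ((7 + e + 2) * (7 + e + 1) * (7 + e)) := by
      ring_nf
      nlinarith [sq_nonneg e, pow_nonneg (Nat.zero_le e) 3]
    omega
  · have : d < 7 := by omega
    interval_cases d
    · exact generic_one k n hn (by simpa [Nat.choose] using h2)
    · exact generic_two k n (by simpa [Nat.choose] using h1) (by simpa [Nat.choose] using h2)
    · exact generic_grid k n 3 2 h2 (le_trans (by decide) h1) (by norm_num)
    · exact generic_of_config k n 4 18 41 h2 (by norm_num)
        (exists_config_20 n (by simpa [Nat.choose] using h1))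
    · exact generic_grid k n 5 3 h2 (le_trans (by decide) h1) (by norm_num)
    · exact generic_grid k n 6 3 h2 (le_trans (by decide) h1) (by norm_num)
end

section
/- Let n ≥ 1 and let s be the integer with C(s,3) < n ≤ C(s+1,3), where C(a,3) denotes the binomial coefficient a choose 3. For points p_1,…,p_n in general position in P^3, let I = ∩_{j=1}^n m_{p_j} be their radical ideal. If γ(I) ≥ (s+1)/3, then I^(3r) ⊆ M^{2r}·I^r for all integers r ≥ 1. -/
open MvPolynomial Filter

section Aux

variable {k : Type*} [Field k] {N n : ℕ}

/-- forms of degree `t` vanishing at all points -/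
noncomputable def formsV (p : Fin n → (Fin (N + 1) → k)) (t : ℕ) :
    Submodule k (MvPolynomial (Fin (N + 1)) k) where
  carrier := { f | f.IsHomogeneous t ∧ ∀ j, eval (p j) f = 0 }
  add_mem' := fun {a b} ha hb => ⟨ha.1.add hb.1, fun j => by simp [ha.2 j, hb.2 j]⟩
  zero_mem' := ⟨isHomogeneous_zero _ _ _, by simp⟩
  smul_mem' := fun c f hf => ⟨(homogeneousSubmodule _ k t).smul_mem c hf.1, fun j => by
    simp [smul_eval, hf.2 j]⟩

/-- linear forms vanishing at a point -/
noncomputable def linV (q : Fin (N + 1) → k) :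
    Submodule k (MvPolynomial (Fin (N + 1)) k) where
  carrier := { f | f.IsHomogeneous 1 ∧ eval q f = 0 }
  add_mem' := fun {a b} ha hb => ⟨ha.1.add hb.1, by simp [ha.2, hb.2]⟩
  zero_mem' := ⟨isHomogeneous_zero _ _ _, by simp⟩
  smul_mem' := fun c f hf => ⟨(homogeneousSubmodule _ k 1).smul_mem c hf.1, by
    simp [smul_eval, hf.2]⟩

lemma mem_formsV {p : Fin n → (Fin (N + 1) → k)} {t : ℕ} {f : MvPolynomial (Fin (N + 1)) k} :
    f ∈ formsV p t ↔ f.IsHomogeneous t ∧ ∀ j, eval (p j) f = 0 := Iff.rfl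

lemma mem_linV {q : Fin (N + 1) → k} {f : MvPolynomial (Fin (N + 1)) k} :
    f ∈ linV q ↔ f.IsHomogeneous 1 ∧ eval q f = 0 := Iff.rfl

/-- restriction of a polynomial to the line through `q` in direction `w` -/
noncomputable def lineMap (q w : Fin (N + 1) → k) :
    MvPolynomial (Fin (N + 1)) k →ₐ[k] Polynomial k :=
  aeval (fun i => Polynomial.C (q i) + Polynomial.X * Polynomial.C (w i))

lemma lineMap_eval (q w : Fin (N + 1) → k) (x : k) (f : MvPolynomial (Fin (N + 1)) k) :
    (lineMap q w f).eval x = eval (fun i => q i + x * w i) f := by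
  induction f using MvPolynomial.induction_on with
  | C a => simp [lineMap]
  | add f g hf hg => simp [hf, hg]
  | mul_X f i hf => simp [hf]; left; simp [lineMap]; ring

lemma lineMap_eval_zero (q w : Fin (N + 1) → k) (f : MvPolynomial (Fin (N + 1)) k) :
    (lineMap q w f).eval 0 = eval q f := by
  rw [lineMap_eval]; simp

lemma X_pow_dvd_lineMap (q w : Fin (N + 1) → k) (r : ℕ) (f : MvPolynomial (Fin (N + 1)) k)
    (hf : f ∈ pointIdeal q ^ r) : (Polynomial.X : Polynomial k) ^ r ∣ lineMap q w f := by
  have h1 : pointIdeal q ≤ Ideal.comap (lineMap q w) (Ideal.span {Polynomial.X}) := by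
    rw [pointIdeal, Ideal.span_le]
    rintro g ⟨-, hg⟩
    rw [SetLike.mem_coe, Ideal.mem_comap, Ideal.mem_span_singleton, Polynomial.X_dvd_iff,
      Polynomial.coeff_zero_eq_eval_zero, lineMap_eval_zero, hg]
  have h2 := (Ideal.pow_right_mono h1 r).trans (Ideal.le_comap_pow _ r) hf
  rwa [Ideal.mem_comap, Ideal.span_singleton_pow, Ideal.mem_span_singleton] at h2

lemma lineMap_linV (q w : Fin (N + 1) → k) (f : MvPolynomial (Fin (N + 1)) k)
    (hf : f ∈ linV q) : lineMap q w f = Polynomial.X * Polynomial.C (eval w f) := by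
  have key : ∀ g : MvPolynomial (Fin (N + 1)) k, g ∈ homogeneousSubmodule (Fin (N + 1)) k 1 →
      lineMap q w g = Polynomial.C (eval q g) + Polynomial.X * Polynomial.C (eval w g) := by
    intro g hg
    rw [homogeneousSubmodule_one_eq_span_X] at hg
    induction hg using Submodule.span_induction with
    | mem x hx => obtain ⟨i, rfl⟩ := hx; simp [lineMap]
    | zero => simp
    | add x y _ _ hx hy => simp [hx, hy]; ring
    | smul a x _ hx => simp [hx, smul_eval, Polynomial.smul_eq_C_mul]; ring
  rw [key f hf.1, hf.2]; simp

lemma lineMap_linV_pow (q w : Fin (N + 1) → k) (r : ℕ) (f : MvPolynomial (Fin (N + 1)) k)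
    (hf : f ∈ linV q ^ r) : lineMap q w f = Polynomial.X ^ r * Polynomial.C (eval w f) := by
  induction r generalizing f with
  | zero =>
    rw [pow_zero, Submodule.mem_one] at hf
    obtain ⟨a, rfl⟩ := hf
    simp [MvPolynomial.algebraMap_eq]
  | succ r ih =>
    rw [pow_succ] at hf
    induction hf using Submodule.mul_induction_on' with
    | mem_mul_mem a ha b hb =>
      rw [map_mul, ih a ha, lineMap_linV q w b hb]; simp; ring
    | add a _ b _ ha hb => rw [map_add, ha, hb]; simp; ring

/-- primary-type statement: a form of degree `r` in linear forms through `q`, multiplied by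
something not vanishing at `q`, is in `m_q^(r+1)` only if zero -/
lemma eq_zero_of_mul_mem [CharZero k] (q : Fin (N + 1) → k) (r : ℕ)
    (g F : MvPolynomial (Fin (N + 1)) k) (hg : eval q g ≠ 0) (hF : F ∈ linV q ^ r)
    (h : g * F ∈ pointIdeal q ^ (r + 1)) : F = 0 := by
  apply MvPolynomial.funext
  intro w
  have h1 := X_pow_dvd_lineMap q w _ _ h
  rw [map_mul, lineMap_linV_pow q w r F hF, pow_succ, mul_left_comm,
    mul_dvd_mul_iff_left (pow_ne_zero _ Polynomial.X_ne_zero), Polynomial.X_dvd_iff,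
    Polynomial.coeff_zero_eq_eval_zero, Polynomial.eval_mul, lineMap_eval_zero,
    Polynomial.eval_C] at h1
  simpa [hg] using h1

lemma H_add (a m : ℕ) : homogeneousSubmodule (Fin (N + 1)) k (a + m) =
    homogeneousSubmodule (Fin (N + 1)) k a * homogeneousSubmodule (Fin (N + 1)) k m := by
  have h := fun t => homogeneousSubmodule_one_pow (σ := Fin (N + 1)) (R := k) t
  rw [← h (a + m), ← h a, ← h m, pow_add]

lemma H_succ (m : ℕ) : homogeneousSubmodule (Fin (N + 1)) k (m + 1) =
    homogeneousSubmodule (Fin (N + 1)) k 1 * homogeneousSubmodule (Fin (N + 1)) k m := by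
  rw [add_comm m 1, H_add]

/-- the linear form `x_i - (q_i/q_0) x_0` -/
lemma lin_decomp (q : Fin (N + 1) → k) (hq : q 0 ≠ 0) (f : MvPolynomial (Fin (N + 1)) k)
    (hf : f.IsHomogeneous 1) : ∃ g ∈ linV q, ∃ a : k, f = g + C a * X 0 := by
  refine ⟨f - C (eval q f / q 0) * X 0, ⟨hf.sub (isHomogeneous_C_mul_X _ _), ?_⟩,
    eval q f / q 0, by ring⟩
  simp [hq]

lemma forms_decomp (q : Fin (N + 1) → k) (hq : q 0 ≠ 0) (m : ℕ)
    (f : MvPolynomial (Fin (N + 1)) k) (hf : f.IsHomogeneous (m + 1)) :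
    ∃ g ∈ linV q * homogeneousSubmodule (Fin (N + 1)) k m, ∃ a : k,
      f = g + C a * X 0 ^ (m + 1) := by
  induction m generalizing f with
  | zero =>
    obtain ⟨g, hg, a, rfl⟩ := lin_decomp q hq f hf
    refine ⟨g, ?_, a, by simp⟩
    have := Submodule.mul_mem_mul hg
      (show (1 : MvPolynomial (Fin (N + 1)) k) ∈ homogeneousSubmodule (Fin (N + 1)) k 0 from
        isHomogeneous_one _ _)
    simpa using this
  | succ m ih =>
    have hf' : f ∈ homogeneousSubmodule (Fin (N + 1)) k (m + 1 + 1) := hf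
    rw [H_succ] at hf'
    induction hf' using Submodule.mul_induction_on' with
    | mem_mul_mem u hu v hv =>
      obtain ⟨g, hg, a, rfl⟩ := lin_decomp q hq u hu
      obtain ⟨g', hg', a', h'⟩ := ih v hv
      refine ⟨g * v + C a * X 0 * g', ?_, a * a', ?_⟩
      · refine Submodule.add_mem _ (Submodule.mul_mem_mul hg hv) ?_
        rw [H_succ, mul_left_comm]
        exact Submodule.mul_mem_mul (isHomogeneous_C_mul_X _ _) hg'
      · rw [add_mul, add_assoc]
        congr 1
        nth_rewrite 1 [h']
        simp only [C_mul]; ring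
    | add u hu v hv h1 h2 =>
      rw [← H_succ] at hu hv
      obtain ⟨g, hg, a, h⟩ := h1 hu
      obtain ⟨g', hg', a', h'⟩ := h2 hv
      exact ⟨g + g', Submodule.add_mem _ hg hg', a + a', by rw [h, h']; simp only [C_add]; ring⟩

lemma linV_mul_eval (q : Fin (N + 1) → k) (P : Submodule k (MvPolynomial (Fin (N + 1)) k))
    (f : MvPolynomial (Fin (N + 1)) k) (hf : f ∈ linV q * P) : eval q f = 0 := by
  induction hf using Submodule.mul_induction_on' with
  | mem_mul_mem u hu v hv => simp [hu.2]
  | add u hu v hv h1 h2 => simp [h1, h2]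

lemma mem_linV_mul (q : Fin (N + 1) → k) (hq : q 0 ≠ 0) (m : ℕ)
    (f : MvPolynomial (Fin (N + 1)) k) (hf : f.IsHomogeneous (m + 1)) (h0 : eval q f = 0) :
    f ∈ linV q * homogeneousSubmodule (Fin (N + 1)) k m := by
  obtain ⟨g, hg, a, rfl⟩ := forms_decomp q hq m f hf
  have := linV_mul_eval q _ g hg
  simp [this, hq] at h0
  simpa [h0] using hg

/-- separators in degree `c + m` -/
noncomputable def esep (p : Fin n → (Fin (N + 1) → k)) (E0 : Fin n → MvPolynomial (Fin (N + 1)) k)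
    (m : ℕ) (j : Fin n) : MvPolynomial (Fin (N + 1)) k :=
  (C (p j 0)⁻¹ * X 0) ^ m * E0 j

lemma esep_hom (p : Fin n → (Fin (N + 1) → k)) (E0 : Fin n → MvPolynomial (Fin (N + 1)) k)
    (c : ℕ) (hE : ∀ j, (E0 j).IsHomogeneous c) (m : ℕ) (j : Fin n) :
    (esep p E0 m j).IsHomogeneous (c + m) := by
  have := ((isHomogeneous_C_mul_X (p j 0)⁻¹ (0 : Fin (N + 1))).pow m).mul (hE j)
  rwa [one_mul, add_comm m c] at this

lemma esep_eval (p : Fin n → (Fin (N + 1) → k)) (hp : ∀ j, p j 0 ≠ 0)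
    (E0 : Fin n → MvPolynomial (Fin (N + 1)) k)
    (hd : ∀ i j, eval (p j) (E0 i) = if i = j then 1 else 0) (m : ℕ) (i j : Fin n) :
    eval (p j) (esep p E0 m i) = if i = j then 1 else 0 := by
  by_cases h : i = j
  · subst h; simp [esep, hd, hp]
  · simp [esep, hd, h]

lemma sep_decomp (p : Fin n → (Fin (N + 1) → k)) (hp : ∀ j, p j 0 ≠ 0)
    (E0 : Fin n → MvPolynomial (Fin (N + 1)) k) (c : ℕ) (hE : ∀ j, (E0 j).IsHomogeneous c)
    (hd : ∀ i j, eval (p j) (E0 i) = if i = j then 1 else 0) (m : ℕ)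
    (f : MvPolynomial (Fin (N + 1)) k) (hf : f.IsHomogeneous (c + m)) :
    f - ∑ j, C (eval (p j) f) * esep p E0 m j ∈ formsV p (c + m) := by
  refine ⟨hf.sub (IsHomogeneous.sum _ _ _ fun j _ => (esep_hom p E0 c hE m j).C_mul _), ?_⟩
  intro j
  simp [esep_eval p hp E0 hd]

lemma sep_decomp_mul (p : Fin n → (Fin (N + 1) → k)) (hp : ∀ j, p j 0 ≠ 0)
    (E0 : Fin n → MvPolynomial (Fin (N + 1)) k) (c : ℕ) (hE : ∀ j, (E0 j).IsHomogeneous c)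
    (hd : ∀ i j, eval (p j) (E0 i) = if i = j then 1 else 0) (m : ℕ)
    (P : Submodule k (MvPolynomial (Fin (N + 1)) k))
    (f : MvPolynomial (Fin (N + 1)) k)
    (hf : f ∈ P * homogeneousSubmodule (Fin (N + 1)) k (c + m)) :
    ∃ g ∈ P * formsV p (c + m), ∃ l : Fin n → MvPolynomial (Fin (N + 1)) k,
      (∀ j, l j ∈ P) ∧ f = g + ∑ j, l j * esep p E0 m j := by
  induction hf using Submodule.mul_induction_on' with
  | mem_mul_mem u hu v hv =>
    refine ⟨u * (v - ∑ j, C (eval (p j) v) * esep p E0 m j),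
      Submodule.mul_mem_mul hu (sep_decomp p hp E0 c hE hd m v hv),
      fun j => C (eval (p j) v) * u, fun j => ?_, ?_⟩
    · show C _ * u ∈ P
      rw [← smul_eq_C_mul]; exact P.smul_mem _ hu
    · rw [mul_sub, Finset.mul_sum]
      simp only [mul_assoc, mul_left_comm]
      rw [sub_add_cancel]
  | add u hu v hv h1 h2 =>
    obtain ⟨g, hg, l, hl, rfl⟩ := h1
    obtain ⟨g', hg', l', hl', rfl⟩ := h2
    refine ⟨g + g', Submodule.add_mem _ hg hg', fun j => l j + l' j,
      fun j => P.add_mem (hl j) (hl' j), ?_⟩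
    simp only [add_mul, Finset.sum_add_distrib]; ring

lemma formsV_mul_mem (p : Fin n → (Fin (N + 1) → k)) (a t : ℕ)
    (u v : MvPolynomial (Fin (N + 1)) k) (hu : u.IsHomogeneous a) (hv : v ∈ formsV p t) :
    u * v ∈ formsV p (a + t) :=
  ⟨hu.mul hv.1, fun j => by simp [hv.2 j]⟩

lemma H_mul_formsV (p : Fin n → (Fin (N + 1) → k)) (a t : ℕ) :
    homogeneousSubmodule (Fin (N + 1)) k a * formsV p t ≤ formsV p (a + t) := by
  rw [Submodule.mul_le]
  intro u hu v hv
  exact formsV_mul_mem p a t u v hu hv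

lemma esep_mul_mem (p : Fin n → (Fin (N + 1) → k)) (hp : ∀ j, p j 0 ≠ 0)
    (E0 : Fin n → MvPolynomial (Fin (N + 1)) k) (c : ℕ) (hE : ∀ j, (E0 j).IsHomogeneous c)
    (hd : ∀ i j, eval (p j) (E0 i) = if i = j then 1 else 0) (m : ℕ) (j : Fin n)
    (l : MvPolynomial (Fin (N + 1)) k) (hl : l ∈ linV (p j)) :
    esep p E0 m j * l ∈ formsV p (c + m + 1) := by
  refine ⟨(esep_hom p E0 c hE m j).mul hl.1, fun i => ?_⟩
  rw [map_mul, esep_eval p hp E0 hd]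
  by_cases h : j = i
  · subst h; simp [hl.2]
  · simp [h]

lemma formsV_gen (p : Fin n → (Fin (N + 1) → k)) (hp : ∀ j, p j 0 ≠ 0)
    (E0 : Fin n → MvPolynomial (Fin (N + 1)) k) (c : ℕ) (hE : ∀ j, (E0 j).IsHomogeneous c)
    (hd : ∀ i j, eval (p j) (E0 i) = if i = j then 1 else 0) (m : ℕ) :
    formsV p (c + m + 1 + 1) ≤
      homogeneousSubmodule (Fin (N + 1)) k 1 * formsV p (c + m + 1) := by
  intro f hf
  have hf' : f ∈ homogeneousSubmodule (Fin (N + 1)) k (c + m + 1 + 1) := hf.1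
  rw [H_succ] at hf'
  obtain ⟨g, hg, l, hl, rfl⟩ := sep_decomp_mul p hp E0 c hE hd (m + 1) _ f hf'
  refine Submodule.add_mem _ hg (Submodule.sum_mem _ fun j _ => ?_)
  have hgj : eval (p j) g = 0 := (H_mul_formsV p _ _ hg).2 j
  have hj := hf.2 j
  simp [hgj, esep_eval p hp E0 hd] at hj
  have h1 : l j * esep p E0 (m + 1) j = (C (p j 0)⁻¹ * X 0) * (esep p E0 m j * l j) := by
    simp only [esep, pow_succ]; ring
  rw [h1]
  exact Submodule.mul_mem_mul (isHomogeneous_C_mul_X _ _)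
    (esep_mul_mem p hp E0 c hE hd m j _ ⟨hl j, hj⟩)

lemma formsV_gen_add (p : Fin n → (Fin (N + 1) → k)) (hp : ∀ j, p j 0 ≠ 0)
    (E0 : Fin n → MvPolynomial (Fin (N + 1)) k) (c : ℕ) (hE : ∀ j, (E0 j).IsHomogeneous c)
    (hd : ∀ i j, eval (p j) (E0 i) = if i = j then 1 else 0) (m e : ℕ) :
    formsV p (c + m + 1 + e) ≤
      homogeneousSubmodule (Fin (N + 1)) k e * formsV p (c + m + 1) := by
  induction e with
  | zero =>
    intro f hf
    have := Submodule.mul_mem_mul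
      (show (1 : MvPolynomial (Fin (N + 1)) k) ∈ homogeneousSubmodule (Fin (N + 1)) k 0 from
        isHomogeneous_one _ _) hf
    simpa using this
  | succ e ih =>
    have h1 := formsV_gen p hp E0 c hE hd (m + e)
    rw [H_succ, mul_assoc]
    have e1 : c + m + 1 + (e + 1) = c + (m + e) + 1 + 1 := by omega
    have e2 : c + m + 1 + e = c + (m + e) + 1 := by omega
    rw [e2] at ih
    rw [e1]
    exact h1.trans (mul_le_mul' le_rfl ih)

/-- distinct points: split the linear form `x_0` -/
lemma split_X0 (q q' : Fin (N + 1) → k) (hq : q 0 ≠ 0) (c : ℕ)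
    (E : MvPolynomial (Fin (N + 1)) k) (hE : E.IsHomogeneous c) (h1 : eval q E = 0)
    (h2 : eval q' E ≠ 0) :
    ∃ u ∈ linV q, ∃ v ∈ linV q', (X 0 : MvPolynomial (Fin (N + 1)) k) = u + v := by
  have hex : ∃ i, q 0 * q' i - q i * q' 0 ≠ 0 := by
    by_contra hcon
    push Not at hcon
    apply h2
    have : q' = fun i => (q' 0 / q 0) * q i := by
      funext i
      have := hcon i
      field_simp
      linear_combination this
    rw [this]
    cases c with
    | zero =>
      rw [← totalDegree_zero_iff_isHomogeneous, totalDegree_eq_zero_iff_eq_C] at hE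
      rw [hE] at h1 ⊢
      simpa using h1
    | succ c =>
      have h4 := mem_linV_mul q hq c E hE h1
      clear h1 h2 hE
      induction h4 using Submodule.mul_induction_on' with
      | mem_mul_mem a ha b hb =>
        have h5 : eval (fun i => (q' 0 / q 0) * q i) a = 0 := by
          have key : ∀ g : MvPolynomial (Fin (N + 1)) k,
              g ∈ homogeneousSubmodule (Fin (N + 1)) k 1 →
              eval (fun i => (q' 0 / q 0) * q i) g = (q' 0 / q 0) * eval q g := by
            intro g hg
            rw [homogeneousSubmodule_one_eq_span_X] at hg
            induction hg using Submodule.span_induction with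
            | mem x hx => obtain ⟨i, rfl⟩ := hx; simp
            | zero => simp
            | add x y _ _ hx hy => simp [hx, hy]; ring
            | smul a x _ hx => simp [hx, smul_eval]; ring
          rw [key a ha.1, ha.2, mul_zero]
        simp [h5]
      | add a _ b _ h1 h2 => simp [h1, h2]
  obtain ⟨i, hi⟩ := hex
  set a : MvPolynomial (Fin (N + 1)) k := C (q 0) * X i - C (q i) * X 0 with ha
  have hah : a.IsHomogeneous 1 := (isHomogeneous_C_mul_X _ _).sub (isHomogeneous_C_mul_X _ _)
  have ha' : eval q' a ≠ 0 := by simpa [ha] using hi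
  refine ⟨C (q' 0 / eval q' a) * a, ⟨hah.C_mul _, by simp [ha]; right; ring⟩,
    X 0 - C (q' 0 / eval q' a) * a, ⟨(isHomogeneous_X _ _).sub (hah.C_mul _), ?_⟩, by ring⟩
  simp [ha']

lemma key_two (p : Fin n → (Fin (N + 1) → k)) (hp : ∀ j, p j 0 ≠ 0)
    (E0 : Fin n → MvPolynomial (Fin (N + 1)) k) (c : ℕ) (hE : ∀ j, (E0 j).IsHomogeneous c)
    (hd : ∀ i j, eval (p j) (E0 i) = if i = j then 1 else 0) (m : ℕ) (j : Fin n)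
    (v : MvPolynomial (Fin (N + 1)) k) (hv : v ∈ formsV p (c + m + 1)) :
    ∃ l ∈ linV (p j), X 0 * esep p E0 m j * v - X 0 * esep p E0 m j * (esep p E0 m j * l) ∈
      formsV p (c + m + 1) * formsV p (c + m + 1) := by
  obtain ⟨g, hg, l, hl, rfl⟩ := sep_decomp_mul p hp E0 c hE hd m _ v
    (mem_linV_mul (p j) (hp j) _ v hv.1 (hv.2 j))
  refine ⟨l j, hl j, ?_⟩
  have hgk : ∀ i, eval (p i) g = 0 := by
    intro i
    clear hv
    induction hg using Submodule.mul_induction_on' with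
    | mem_mul_mem a ha b hb => simp [hb.2 i]
    | add a _ b _ h1 h2 => simp [h1, h2]
  have hlk : ∀ i, eval (p i) (l i) = 0 := by
    intro i
    have := hv.2 i
    simpa [hgk, esep_eval p hp E0 hd] using this
  have hg2 : X 0 * esep p E0 m j * g ∈ formsV p (c + m + 1) * formsV p (c + m + 1) := by
    clear hgk hv
    induction hg using Submodule.mul_induction_on' with
    | mem_mul_mem a ha b hb =>
      have : X 0 * esep p E0 m j * (a * b) = (esep p E0 m j * a) * (X 0 * b) := by ring
      rw [this]
      refine Submodule.mul_mem_mul (esep_mul_mem p hp E0 c hE hd m j a ha) ?_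
      have := formsV_mul_mem p 1 (c + m) (X 0) b (isHomogeneous_X _ _) hb
      rwa [add_comm 1 (c + m)] at this
    | add a _ b _ h1 h2 => rw [mul_add]; exact Submodule.add_mem _ h1 h2
  have hs : X 0 * esep p E0 m j * (g + ∑ i, l i * esep p E0 m i) -
      X 0 * esep p E0 m j * (esep p E0 m j * l j) =
      X 0 * esep p E0 m j * g + ∑ i ∈ Finset.univ.erase j,
        X 0 * esep p E0 m j * (l i * esep p E0 m i) := by
    rw [← Finset.add_sum_erase _ _ (Finset.mem_univ j), ← Finset.mul_sum]
    ring
  rw [hs]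
  refine Submodule.add_mem _ hg2 (Submodule.sum_mem _ fun i hi => ?_)
  have hij : i ≠ j := Finset.ne_of_mem_erase hi
  obtain ⟨u, hu, w, hw, huw⟩ := split_X0 (p j) (p i) (hp j) c (E0 i) (hE i)
    (by simp [hd, hij]) (by simp [hd])
  have : X 0 * esep p E0 m j * (l i * esep p E0 m i) =
      (esep p E0 m j * u) * (esep p E0 m i * l i) +
      (esep p E0 m j * l i) * (esep p E0 m i * w) := by
    rw [huw]; ring
  rw [this]
  have hl' : l i ∈ linV (p i) := ⟨(hl i).1, hlk i⟩
  exact Submodule.add_mem _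
    (Submodule.mul_mem_mul (esep_mul_mem p hp E0 c hE hd m j u hu)
      (esep_mul_mem p hp E0 c hE hd m i _ hl'))
    (Submodule.mul_mem_mul (esep_mul_mem p hp E0 c hE hd m j _ (hl i))
      (esep_mul_mem p hp E0 c hE hd m i _ hw))

lemma key_pow (p : Fin n → (Fin (N + 1) → k)) (hp : ∀ j, p j 0 ≠ 0)
    (E0 : Fin n → MvPolynomial (Fin (N + 1)) k) (c : ℕ) (hE : ∀ j, (E0 j).IsHomogeneous c)
    (hd : ∀ i j, eval (p j) (E0 i) = if i = j then 1 else 0) (m : ℕ) (j : Fin n) (r : ℕ)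
    (f : MvPolynomial (Fin (N + 1)) k) (hf : f ∈ formsV p (c + m + 1) ^ r) :
    ∃ F ∈ linV (p j) ^ r,
      X 0 * esep p E0 m j * f - X 0 * esep p E0 m j * (esep p E0 m j ^ r * F) ∈
      formsV p (c + m + 1) ^ (r + 1) := by
  induction r generalizing f with
  | zero => exact ⟨f, by simpa using hf, by simp⟩
  | succ r ih =>
    rw [pow_succ] at hf
    induction hf using Submodule.mul_induction_on' with
    | mem_mul_mem a ha v hv =>
      obtain ⟨l, hl, h1⟩ := key_two p hp E0 c hE hd m j v hv
      obtain ⟨F, hF, h2⟩ := ih a ha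
      refine ⟨F * l, by rw [pow_succ]; exact Submodule.mul_mem_mul hF hl, ?_⟩
      have : X 0 * esep p E0 m j * (a * v) -
          X 0 * esep p E0 m j * (esep p E0 m j ^ (r + 1) * (F * l)) =
          a * (X 0 * esep p E0 m j * v - X 0 * esep p E0 m j * (esep p E0 m j * l)) +
          (X 0 * esep p E0 m j * a - X 0 * esep p E0 m j * (esep p E0 m j ^ r * F)) *
            (esep p E0 m j * l) := by ring
      rw [this]
      refine Submodule.add_mem _ ?_ ?_
      · have := Submodule.mul_mem_mul ha h1
        rwa [← mul_assoc, ← pow_succ, ← pow_succ] at this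
      · have := Submodule.mul_mem_mul h2 (esep_mul_mem p hp E0 c hE hd m j l hl)
        rwa [← pow_succ] at this
    | add a _ b _ h1 h2 =>
      obtain ⟨F, hF, h1⟩ := h1
      obtain ⟨G, hG, h2⟩ := h2
      refine ⟨F + G, Submodule.add_mem _ hF hG, ?_⟩
      have := Submodule.add_mem _ h1 h2
      convert this using 1
      ring

lemma formsV_le_pointIdeal (p : Fin n → (Fin (N + 1) → k)) (t : ℕ) (j : Fin n)
    (f : MvPolynomial (Fin (N + 1)) k) (hf : f ∈ formsV p t) : f ∈ pointIdeal (p j) :=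
  Ideal.subset_span ⟨⟨t, hf.1⟩, hf.2 j⟩

lemma pow_mem_ideal (P : Submodule k (MvPolynomial (Fin (N + 1)) k))
    (I : Ideal (MvPolynomial (Fin (N + 1)) k)) (h : ∀ x ∈ P, x ∈ I) (r : ℕ)
    (f : MvPolynomial (Fin (N + 1)) k) (hf : f ∈ P ^ r) : f ∈ I ^ r := by
  induction r generalizing f with
  | zero => simp
  | succ r ih =>
    rw [pow_succ] at hf ⊢
    induction hf using Submodule.mul_induction_on' with
    | mem_mul_mem a ha v hv => exact Ideal.mul_mem_mul (ih a ha) (h v hv)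
    | add a _ b _ h1 h2 => exact Ideal.add_mem _ h1 h2

lemma pow_mul_mem_ideal (P Q : Submodule k (MvPolynomial (Fin (N + 1)) k))
    (I : Ideal (MvPolynomial (Fin (N + 1)) k)) (h : ∀ x ∈ P, x ∈ I) (r : ℕ)
    (f : MvPolynomial (Fin (N + 1)) k) (hf : f ∈ P ^ r * Q) : f ∈ I ^ r := by
  induction hf using Submodule.mul_induction_on' with
  | mem_mul_mem a ha v hv => exact Ideal.mul_mem_right _ _ (pow_mem_ideal P I h r a ha)
  | add a _ b _ h1 h2 => exact Ideal.add_mem _ h1 h2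

lemma main_mem [CharZero k] (p : Fin n → (Fin (N + 1) → k)) (hp : ∀ j, p j 0 ≠ 0)
    (E0 : Fin n → MvPolynomial (Fin (N + 1)) k) (c : ℕ) (hE : ∀ j, (E0 j).IsHomogeneous c)
    (hd : ∀ i j, eval (p j) (E0 i) = if i = j then 1 else 0) (m r e : ℕ)
    (f : MvPolynomial (Fin (N + 1)) k) (hf : ∀ j, f ∈ pointIdeal (p j) ^ r)
    (hfh : f.IsHomogeneous (r * (c + m + 1) + e)) :
    f ∈ formsV p (c + m + 1) ^ r * homogeneousSubmodule (Fin (N + 1)) k e := by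
  induction r generalizing e with
  | zero => simpa using hfh
  | succ r ih =>
    have e1 : (r + 1) * (c + m + 1) + e = r * (c + m + 1) + (c + (m + 1 + e)) := by ring
    rw [e1] at hfh
    have h1 := ih _ (fun j => Ideal.pow_le_pow_right (Nat.le_succ r) (hf j)) hfh
    obtain ⟨g, hg, l, hl, hfg⟩ := sep_decomp_mul p hp E0 c hE hd (m + 1 + e) _ f h1
    choose F hF hF' using fun j => key_pow p hp E0 c hE hd m j r (l j) (hl j)
    have hsplit : ∀ j, esep p E0 (m + 1 + e) j =
        (C (p j 0)⁻¹ ^ (1 + e) * X 0 ^ e) * (X 0 * esep p E0 m j) := by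
      intro j; simp only [esep]; ring
    have hVI : ∀ j, ∀ x ∈ formsV p (c + m + 1), x ∈ pointIdeal (p j) :=
      fun j x hx => formsV_le_pointIdeal p _ j x hx
    have hU : ∀ j, (C (p j 0)⁻¹ ^ (1 + e) * X 0 ^ e : MvPolynomial (Fin (N + 1)) k) ∈
        homogeneousSubmodule (Fin (N + 1)) k e := by
      intro j
      rw [← C_pow]
      exact isHomogeneous_C_mul_X_pow _ _ _
    have hG1 : g ∈ formsV p (c + m + 1) ^ (r + 1) * homogeneousSubmodule (Fin (N + 1)) k e := by
      have h2 := formsV_gen_add p hp E0 c hE hd m e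
      rw [show c + m + 1 + e = c + (m + 1 + e) by ring, mul_comm] at h2
      have h3 := mul_le_mul' (le_refl (formsV p (c + m + 1) ^ r)) h2 hg
      rwa [← mul_assoc, ← pow_succ] at h3
    set G := g + ∑ j, (X 0 * esep p E0 m j * l j -
      X 0 * esep p E0 m j * (esep p E0 m j ^ r * F j)) * (C (p j 0)⁻¹ ^ (1 + e) * X 0 ^ e) with hG
    have hGm : G ∈ formsV p (c + m + 1) ^ (r + 1) * homogeneousSubmodule (Fin (N + 1)) k e :=
      Submodule.add_mem _ hG1 (Submodule.sum_mem _ fun j _ =>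
        Submodule.mul_mem_mul (hF' j) (hU j))
    have hfG : f = G + ∑ j, (C (p j 0)⁻¹ ^ (1 + e) * X 0 ^ e * X 0 * esep p E0 m j ^ (r + 1)) *
        F j := by
      rw [hfg, hG, add_assoc g, ← Finset.sum_add_distrib]
      congr 1
      refine Finset.sum_congr rfl fun j _ => ?_
      rw [hsplit]; ring
    have hF0 : ∀ j, F j = 0 := by
      intro j
      refine eq_zero_of_mul_mem (p j) r
        (C (p j 0)⁻¹ ^ (1 + e) * X 0 ^ e * X 0 * esep p E0 m j ^ (r + 1)) (F j) ?_ (hF j) ?_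
      · simp [hp j, esep_eval p hp E0 hd]
      · have h4 : (C (p j 0)⁻¹ ^ (1 + e) * X 0 ^ e * X 0 * esep p E0 m j ^ (r + 1)) * F j =
            f - G - ∑ i ∈ Finset.univ.erase j,
              (C (p i 0)⁻¹ ^ (1 + e) * X 0 ^ e * X 0 * esep p E0 m i ^ (r + 1)) * F i := by
          rw [hfG, ← Finset.add_sum_erase _ _ (Finset.mem_univ j)]; ring
        rw [h4]
        refine Ideal.sub_mem _ (Ideal.sub_mem _ (hf j)
          (pow_mul_mem_ideal _ _ _ (hVI j) _ _ hGm)) (Ideal.sum_mem _ fun i hi => ?_)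
        have hij : i ≠ j := Finset.ne_of_mem_erase hi
        refine Ideal.mul_mem_right _ _ (Ideal.mul_mem_left _ _ (Ideal.pow_mem_pow ?_ _))
        exact Ideal.subset_span ⟨⟨_, esep_hom p E0 c hE m i⟩, by
          simp [esep_eval p hp E0 hd, hij]⟩
    rw [hfG]
    simpa [hF0] using hGm

lemma mem_maxIdeal (f : MvPolynomial (Fin (N + 1)) k) (hf : f.IsHomogeneous 1) :
    f ∈ maxIdeal k N := by
  have hg : f ∈ homogeneousSubmodule (Fin (N + 1)) k 1 := hf
  rw [homogeneousSubmodule_one_eq_span_X] at hg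
  induction hg using Submodule.span_induction with
  | mem x hx => exact Ideal.subset_span hx
  | zero => exact Ideal.zero_mem _
  | add x y hx' hy' hx hy =>
    rw [← homogeneousSubmodule_one_eq_span_X] at hx' hy'
    exact Ideal.add_mem _ (hx hx') (hy hy')
  | smul a x hx' hx =>
    rw [← homogeneousSubmodule_one_eq_span_X] at hx'
    rw [smul_eq_C_mul]
    exact Ideal.mul_mem_left _ _ (hx hx')

lemma formsV_le_fat (p : Fin n → (Fin (N + 1) → k)) (hp : ∀ j, p j 0 ≠ 0)
    (E0 : Fin n → MvPolynomial (Fin (N + 1)) k) (c : ℕ) (hE : ∀ j, (E0 j).IsHomogeneous c)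
    (hd : ∀ i j, eval (p j) (E0 i) = if i = j then 1 else 0)
    (f : MvPolynomial (Fin (N + 1)) k) (hf : f ∈ formsV p (c + 2 + 1)) :
    f ∈ maxIdeal k N ^ 2 * fatIdeal p (fun _ => 1) := by
  have h1 := formsV_gen_add p hp E0 c hE hd 0 2 (by simpa [add_assoc] using hf)
  induction h1 using Submodule.mul_induction_on' with
  | mem_mul_mem a ha v hv =>
    refine Ideal.mul_mem_mul ?_ ?_
    · have ha' : a ∈ homogeneousSubmodule (Fin (N + 1)) k 1 ^ 2 := by
        rw [homogeneousSubmodule_one_pow]; exact ha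
      exact pow_mem_ideal _ _ (fun x hx => mem_maxIdeal x hx) 2 a ha'
    · rw [fatIdeal, Submodule.mem_iInf]
      intro j
      rw [pow_one]
      exact formsV_le_pointIdeal p _ j v hv
  | add a ha b hb h1 h2 =>
    have hsub : homogeneousSubmodule (Fin (N + 1)) k 2 * formsV p (c + 0 + 1) ≤
        formsV p (c + 2 + 1) := by
      have := H_mul_formsV p 2 (c + 0 + 1)
      rwa [show 2 + (c + 0 + 1) = c + 2 + 1 by ring] at this
    exact Ideal.add_mem _ (h1 (hsub ha)) (h2 (hsub hb))

attribute [local instance] MvPolynomial.gradedAlgebra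

lemma fat_homogeneous (p : Fin n → (Fin (N + 1) → k)) (m : Fin n → ℕ) :
    (fatIdeal p m).IsHomogeneous (homogeneousSubmodule (Fin (N + 1)) k) := by
  unfold fatIdeal
  refine Ideal.IsHomogeneous.iInf fun j => ?_
  have h1 : (pointIdeal (p j)).IsHomogeneous (homogeneousSubmodule (Fin (N + 1)) k) := by
    refine Ideal.homogeneous_span _ _ ?_
    rintro f ⟨⟨d, hd⟩, -⟩
    exact ⟨d, hd⟩
  induction m j with
  | zero => rw [pow_zero, Ideal.one_eq_top]; exact Ideal.IsHomogeneous.top _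
  | succ t ih => rw [pow_succ]; exact ih.mul h1

lemma degree_ge (p : Fin n → (Fin (N + 1) → k)) (s r t : ℕ) (hr : 1 ≤ r)
    (γ : ℝ) (hγ : Tendsto (alphaSeq p (fun _ => 1)) atTop (nhds γ)) (hs : ((s : ℝ) + 1) / 3 ≤ γ)
    (f : MvPolynomial (Fin (N + 1)) k) (hf : f ∈ fatIdeal p (fun _ => 3 * r)) (h0 : f ≠ 0)
    (hfh : f.IsHomogeneous t) : r * (s + 1) ≤ t := by
  have hsub : Tendsto (fun m : ℕ => 3 * r * m) atTop atTop :=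
    tendsto_id.const_mul_atTop' (by omega)
  have h1 := hγ.comp hsub
  have hr' : (0 : ℝ) < r := by exact_mod_cast hr
  have h2 : γ ≤ t / (3 * r) := by
    refine le_of_tendsto h1 ?_
    filter_upwards [eventually_ge_atTop 1] with m hm
    have hm' : (0 : ℝ) < m := by exact_mod_cast hm
    have h3 : alpha (fatIdeal p fun _ => 3 * r * m * 1) ≤ t * m := by
      refine Nat.sInf_le ⟨f ^ m, ?_, pow_ne_zero _ h0, hfh.pow m⟩
      rw [fatIdeal, Submodule.mem_iInf] at hf ⊢
      intro j
      rw [mul_one, pow_mul]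
      exact Ideal.pow_mem_pow (hf j) m
    have h3' : (alpha (fatIdeal p fun _ => 3 * r * m * 1) : ℝ) ≤ t * m := by exact_mod_cast h3
    simp only [Function.comp, alphaSeq]
    push_cast
    rw [div_le_div_iff₀ (by positivity) (by positivity)]
    nlinarith [mul_le_mul_of_nonneg_right h3' (show (0 : ℝ) ≤ 3 * r by positivity)]
  have h4 := hs.trans h2
  rw [div_le_div_iff₀ (by positivity) (by positivity)] at h4
  have : (r : ℝ) * (s + 1) ≤ t := by linarith
  exact_mod_cast this

lemma containment [CharZero k] (p : Fin n → (Fin (N + 1) → k)) (hp : ∀ j, p j 0 ≠ 0)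
    (E0 : Fin n → MvPolynomial (Fin (N + 1)) k) (c : ℕ) (hE : ∀ j, (E0 j).IsHomogeneous c)
    (hd : ∀ i j, eval (p j) (E0 i) = if i = j then 1 else 0)
    (γ : ℝ) (hγ : Tendsto (alphaSeq p (fun _ => 1)) atTop (nhds γ))
    (hs : (((c + 2 : ℕ) : ℝ) + 1) / 3 ≤ γ) (r : ℕ) (hr : 1 ≤ r) :
    fatIdeal p (fun _ => 3 * r) ≤ maxIdeal k N ^ (2 * r) * (fatIdeal p (fun _ => 1)) ^ r := by
  intro f hf
  rw [← sum_homogeneousComponent f]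
  refine Ideal.sum_mem _ fun t _ => ?_
  have hft : homogeneousComponent t f ∈ fatIdeal p (fun _ => 3 * r) :=
    homogeneousComponent_mem_of_mem (fat_homogeneous p _) hf t
  by_cases h0 : homogeneousComponent t f = 0
  · rw [h0]; exact Ideal.zero_mem _
  have hh := homogeneousComponent_isHomogeneous t f
  have ht := degree_ge p (c + 2) r t hr γ hγ hs _ hft h0 hh
  obtain ⟨e, rfl⟩ := Nat.exists_eq_add_of_le ht
  have hfj : ∀ j, homogeneousComponent (r * (c + 2 + 1) + e) f ∈ pointIdeal (p j) ^ r := by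
    intro j
    rw [fatIdeal, Submodule.mem_iInf] at hft
    exact Ideal.pow_le_pow_right (by omega) (hft j)
  have hm := main_mem p hp E0 c hE hd 2 r e _ hfj hh
  rw [pow_mul, ← mul_pow]
  exact pow_mul_mem_ideal _ _ _ (fun x hx => formsV_le_fat p hp E0 c hE hd x hx) r _ hm

lemma exists_monos (c : ℕ) (hn : n ≤ Nat.choose (c + 3) 3) :
    ∃ E : Fin n → MvPolynomial (Fin (3 + 1)) k, (∀ j, (E j).IsHomogeneous c) ∧
      LinearIndependent k E := by
  have hcard : (Finset.finsuppAntidiag (Finset.univ : Finset (Fin (3 + 1))) c).card =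
      Nat.choose (c + 3) 3 := by
    rw [Finset.card_finsuppAntidiag_nat_eq_choose]
    simp
    rw [add_comm 3 c, Nat.choose_symm_add]
  obtain ⟨T, hT, hTc⟩ := Finset.exists_subset_card_eq (hcard ▸ hn)
  let e := (T.equivFinOfCardEq hTc).symm
  refine ⟨fun i => monomial (e i : Fin (3 + 1) →₀ ℕ) 1, fun i => ?_, ?_⟩
  · refine isHomogeneous_monomial _ ?_
    have := hT (e i).2
    rw [Finset.mem_finsuppAntidiag] at this
    rw [Finsupp.degree_eq_sum]
    exact this.1
  · have h1 := (basisMonomials (Fin (3 + 1)) k).linearIndependent.comp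
      (fun i => (e i : Fin (3 + 1) →₀ ℕ)) (Subtype.val_injective.comp e.injective)
    simpa [Function.comp_def] using h1

lemma exists_points [CharZero k] (E : Fin n → MvPolynomial (Fin (N + 1)) k)
    (hE : LinearIndependent k E) :
    ∃ p : Fin n → (Fin (N + 1) → k), (∀ j, p j 0 ≠ 0) ∧
      (Matrix.of fun j i => eval (p j) (E i)).det ≠ 0 := by
  let S : Set (Fin n → k) :=
    { v | ∃ q : Fin (N + 1) → k, q 0 ≠ 0 ∧ v = fun i => eval q (E i) }
  have hS : Submodule.span k S = ⊤ := by
    by_contra hne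
    obtain ⟨φ, hφ, hle⟩ := Submodule.exists_le_ker_of_lt_top _ (lt_top_iff_ne_top.mpr hne)
    apply hφ
    have h1 : ∑ i, φ (Pi.single i 1) • E i = 0 := by
      have h2 : X 0 * ∑ i, φ (Pi.single i 1) • E i = 0 := by
        apply MvPolynomial.funext
        intro q
        by_cases hq : q 0 = 0
        · simp [hq]
        · have h3 : φ (fun i => eval q (E i)) = 0 := hle (Submodule.subset_span ⟨q, hq, rfl⟩)
          rw [LinearMap.pi_apply_eq_sum_univ] at h3
          simp only [map_mul, map_sum, smul_eval, map_zero]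
          rw [mul_eq_zero]; right
          rw [← h3]
          refine Finset.sum_congr rfl fun i _ => ?_
          rw [smul_eq_mul, mul_comm]
          congr 2
          funext j
          simp [Pi.single_apply, eq_comm]
      exact (mul_eq_zero.mp h2).resolve_left (X_ne_zero _)
    have h4 := Fintype.linearIndependent_iff.mp hE _ h1
    apply LinearMap.pi_ext'
    intro i
    ext
    simpa using h4 i
  obtain ⟨f, hf, -, hli⟩ := Submodule.exists_fun_fin_finrank_span_eq k S
  have hfr : Module.finrank k (Submodule.span k S) = n := by rw [hS]; simp
  choose q hq0 hq using hf
  have hli' := hli.comp (finCongr hfr.symm) (finCongr hfr.symm).injective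
  refine ⟨fun j => q (finCongr hfr.symm j), fun j => hq0 _, ?_⟩
  rw [← isUnit_iff_ne_zero, ← Matrix.isUnit_iff_isUnit_det,
    ← Matrix.linearIndependent_rows_iff_isUnit]
  have heq : (Matrix.of fun j i => eval (q (finCongr hfr.symm j)) (E i)).row =
      f ∘ (finCongr hfr.symm) := by
    funext j
    exact (hq _).symm
  rw [heq]
  exact hli'

end Aux
/-- Let `n ≥ 1` and let `s` satisfy `C(s,3) < n ≤ C(s+1,3)`. For `n` points in
general position in `ℙ³` with radical ideal `I`: if `γ(I) ≥ (s+1)/3` then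
`I^(3r) ⊆ M^(2r) * I^r` for all `r ≥ 1`. -/
theorem statement15 (k : Type*) [Field k] [CharZero k] (n s : ℕ) (hn : 1 ≤ n)
    (hs1 : Nat.choose s 3 < n) (hs2 : n ≤ Nat.choose (s + 1) 3) :
    Generic k 3 n (fun p =>
      (∃ γ : ℝ, Tendsto (alphaSeq p (fun _ => 1)) atTop (nhds γ) ∧
        ((s : ℝ) + 1) / 3 ≤ γ) →
      ∀ r : ℕ, 1 ≤ r →
        fatIdeal p (fun _ => 3 * r) ≤
          maxIdeal k 3 ^ (2 * r) * (fatIdeal p (fun _ => 1)) ^ r) := by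
  obtain ⟨c, rfl⟩ : ∃ c, s = c + 2 := by
    rcases s with _ | _ | c
    · norm_num [Nat.choose] at hs2; omega
    · norm_num [Nat.choose] at hs2; omega
    · exact ⟨c, rfl⟩
  obtain ⟨E, hEh, hEl⟩ := exists_monos (k := k) c hs2
  obtain ⟨p0, hp0, hdet0⟩ := exists_points E hEl
  let G : MvPolynomial (Fin n × Fin (3 + 1)) k :=
    (∏ j, X (j, 0)) * (Matrix.of fun j i => rename (fun a => (j, a)) (E i)).det
  have hG : ∀ p : Fin n → Fin (3 + 1) → k, eval (fun q => p q.1 q.2) G =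
      (∏ j, p j 0) * (Matrix.of fun j i => eval (p j) (E i)).det := by
    intro p
    simp only [G, map_mul, map_prod, eval_X, RingHom.map_det]
    congr 2
    ext j i
    simp [eval_rename, Function.comp_def]
  refine ⟨{G}, ⟨p0, fun j h => hp0 j (by rw [h]; rfl), G, rfl, ?_⟩, ?_⟩
  · rw [hG]
    exact mul_ne_zero (Finset.prod_ne_zero_iff.mpr fun j _ => hp0 j) hdet0
  · rintro p - ⟨f, rfl, hf⟩ ⟨γ, hγ, hs⟩ r hr
    rw [hG] at hf
    have hp : ∀ j, p j 0 ≠ 0 := fun j =>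
      Finset.prod_ne_zero_iff.mp (left_ne_zero_of_mul hf) j (Finset.mem_univ j)
    have hdet := right_ne_zero_of_mul hf
    set A : Matrix (Fin n) (Fin n) k := Matrix.of fun j i => eval (p j) (E i) with hA
    have hinv : A * A⁻¹ = 1 := Matrix.mul_nonsing_inv _ (isUnit_iff_ne_zero.mpr hdet)
    refine containment p hp (fun i => ∑ l, C (A⁻¹ l i) * E l) c
      (fun j => IsHomogeneous.sum _ _ _ fun l _ => (hEh l).C_mul _) ?_ γ hγ hs r hr
    intro i j
    have := congrFun (congrFun hinv j) i
    rw [Matrix.mul_apply, Matrix.one_apply] at this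
    simp only [map_sum, map_mul, eval_C]
    rw [eq_comm] at this
    simp only [eq_comm (a := i)]
    rw [this]
    exact Finset.sum_congr rfl fun l _ => by rw [mul_comm]; rfl
end
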